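/- (Asymptotic normality of the CLS estimator, Theorem 1.) Let (X_t)_{t≥0} be the canonical stationary BAR(1) chain with true parameters (ρ, p), and let (ρ̂_n, p̂_n) be the CLS estimators computed from X_0,…,X_n (defined arbitrarily on the null set where the defining denominators vanish). Let V = diag(N p(1−p), N²(1−ρ)²). Then the law of √n·(ρ̂_n − ρ, p̂_n − p) converges weakly, as n → ∞, to the centered two-dimensional Gaussian distribution with covariance matrix V⁻¹ W_CLS V⁻¹. -/

import Mathlib

open MeasureTheory Filter Finset Matrix

noncomputable section

/-- BAR(1) one-step transition probability `K(i,{j})` with parameters `(ρ, p)`,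
where `β = p(1-ρ)` and `α = β + ρ`. -/
def barK (N : ℕ) (ρ p : ℝ) (i j : ℕ) : ℝ :=
  ∑ k ∈ Finset.Icc (i + j - N) (min i j),
    (Nat.choose i k : ℝ) * (Nat.choose (N - i) (j - k)) *
      (p * (1 - ρ) + ρ) ^ k * (1 - (p * (1 - ρ) + ρ)) ^ (i - k) *
      (p * (1 - ρ)) ^ (j - k) * (1 - p * (1 - ρ)) ^ (N + k - (i + j))

/-- Binomial(N,p) probability mass function. -/
def binomPMF (N : ℕ) (p : ℝ) (i : ℕ) : ℝ :=
  (Nat.choose N i : ℝ) * p ^ i * (1 - p) ^ (N - i)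

/-- CLS estimator of ρ from observations `x 0, …, x n`. -/
def clsRho (x : ℕ → ℝ) (n : ℕ) : ℝ :=
  ((n : ℝ) * ∑ t ∈ Finset.Icc 1 n, x t * x (t - 1)
      - (∑ t ∈ Finset.Icc 1 n, x t) * (∑ t ∈ Finset.Icc 1 n, x (t - 1))) /
    ((n : ℝ) * ∑ t ∈ Finset.Icc 1 n, (x (t - 1)) ^ 2
      - (∑ t ∈ Finset.Icc 1 n, x (t - 1)) ^ 2)

/-- CLS estimator of p from observations `x 0, …, x n`. -/
def clsP (N : ℕ) (x : ℕ → ℝ) (n : ℕ) : ℝ :=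
  ((∑ t ∈ Finset.Icc 1 n, x t) - clsRho x n * ∑ t ∈ Finset.Icc 1 n, x (t - 1)) /
    ((n : ℝ) * N * (1 - clsRho x n))

/-- The real-valued observation sequence attached to a trajectory `ω`. -/
def xR (ω : ℕ → ℕ) (t : ℕ) : ℝ := (ω t : ℝ)

/-- Conditional variance σ²(i) of the BAR(1) model. -/
def sigmaSq (N : ℕ) (ρ p : ℝ) (i : ℕ) : ℝ :=
  ρ * (1 - ρ) * (1 - 2 * p) * i + N * p * (1 - ρ) * (1 - p * (1 - ρ))

/-- The matrix `W_CLS`. -/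
def Wcls (N : ℕ) (ρ p : ℝ) : Matrix (Fin 2) (Fin 2) ℝ :=
  !![∑ i ∈ Finset.range (N + 1), binomPMF N p i * ((i : ℝ) - N * p) ^ 2 * sigmaSq N ρ p i,
     (N : ℝ) * (1 - ρ) *
       ∑ i ∈ Finset.range (N + 1), binomPMF N p i * ((i : ℝ) - N * p) * sigmaSq N ρ p i;
     (N : ℝ) * (1 - ρ) *
       ∑ i ∈ Finset.range (N + 1), binomPMF N p i * ((i : ℝ) - N * p) * sigmaSq N ρ p i,
     (N : ℝ) ^ 2 * (1 - ρ) ^ 2 * ∑ i ∈ Finset.range (N + 1), binomPMF N p i * sigmaSq N ρ p i]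

/-- The matrix `V = diag(N p (1-p), N² (1-ρ)²)`. -/
def Vmat (N : ℕ) (ρ p : ℝ) : Matrix (Fin 2) (Fin 2) ℝ :=
  Matrix.diagonal ![(N : ℝ) * p * (1 - p), (N : ℝ) ^ 2 * (1 - ρ) ^ 2]

def bp (a : ℝ) : Polynomial ℝ := Polynomial.C a * Polynomial.X + Polynomial.C (1 - a)

lemma coeff_bp_pow (a : ℝ) (n k : ℕ) :
    ((bp a) ^ n).coeff k = (Nat.choose n k : ℝ) * a ^ k * (1 - a) ^ (n - k) := by
  unfold bp
  rw [add_pow, Polynomial.finsetSum_coeff]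
  have : ∀ m ∈ range (n + 1), ((Polynomial.C a * Polynomial.X) ^ m * (Polynomial.C (1 - a)) ^ (n - m)
      * ((n.choose m : ℕ) : Polynomial ℝ)).coeff k
      = if m = k then (Nat.choose n k : ℝ) * a ^ k * (1 - a) ^ (n - k) else 0 := by
    intro m _
    have e : (Polynomial.C a * Polynomial.X) ^ m * (Polynomial.C (1 - a)) ^ (n - m)
      * ((n.choose m : ℕ) : Polynomial ℝ)
      = Polynomial.C ((Nat.choose n m : ℝ) * a ^ m * (1 - a) ^ (n - m)) * Polynomial.X ^ m := by
      simp only [mul_pow, map_mul, map_pow, map_natCast]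
      ring
    rw [e, Polynomial.coeff_C_mul, Polynomial.coeff_X_pow]
    by_cases hmk : m = k
    · subst hmk; simp
    · simp [hmk, Ne.symm hmk]
  rw [Finset.sum_congr rfl this, Finset.sum_ite_eq']
  split_ifs with hk
  · rfl
  · rw [Finset.mem_range, not_lt] at hk
    simp [Nat.choose_eq_zero_of_lt (show n < k by omega)]

lemma binomPMF_coeff (N : ℕ) (p : ℝ) (i : ℕ) : binomPMF N p i = ((bp p) ^ N).coeff i := by
  rw [coeff_bp_pow]; rfl

lemma barK_coeff (N : ℕ) (ρ p : ℝ) (i j : ℕ) (hi : i ≤ N) :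
    barK N ρ p i j = ((bp (p * (1 - ρ) + ρ)) ^ i * (bp (p * (1 - ρ))) ^ (N - i)).coeff j := by
  rw [Polynomial.coeff_mul, Finset.Nat.sum_antidiagonal_eq_sum_range_succ_mk]
  unfold barK
  symm
  rw [← Finset.sum_subset (s₁ := Finset.Icc (i + j - N) (min i j))]
  · refine Finset.sum_congr rfl fun m hm => ?_
    rw [Finset.mem_Icc, le_min_iff] at hm
    simp only [coeff_bp_pow]
    rw [show N - i - (j - m) = N + m - (i + j) by omega]
    ring
  · intro m hm
    rw [Finset.mem_Icc, le_min_iff] at hm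
    rw [Finset.mem_range]; omega
  · intro m hm hm'
    rw [Finset.mem_range] at hm
    rw [Finset.mem_Icc, le_min_iff] at hm'
    simp only [coeff_bp_pow]
    by_cases h1 : i < m
    · simp [Nat.choose_eq_zero_of_lt h1]
    · have : N - i < j - m := by omega
      simp [Nat.choose_eq_zero_of_lt this]

lemma natDegree_bp (a : ℝ) : (bp a).natDegree ≤ 1 := Polynomial.natDegree_linear_le

lemma natDegree_pp (a b : ℝ) (m l : ℕ) : ((bp a) ^ m * (bp b) ^ l).natDegree ≤ m + l := by
  refine Polynomial.natDegree_mul_le.trans (add_le_add ?_ ?_)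
  · simpa using Polynomial.natDegree_pow_le_of_le m (natDegree_bp a)
  · simpa using Polynomial.natDegree_pow_le_of_le l (natDegree_bp b)

lemma coeff_sum0 (P : Polynomial ℝ) (N : ℕ) (h : P.natDegree ≤ N) :
    ∑ j ∈ range (N + 1), P.coeff j = P.eval 1 := by
  rw [Polynomial.eval_eq_sum_range' (n := N + 1) (by omega)]
  simp

lemma coeff_sum1 (P : Polynomial ℝ) (N : ℕ) (h : P.natDegree ≤ N) :
    ∑ j ∈ range (N + 1), P.coeff j * j = P.derivative.eval 1 := by
  rw [Polynomial.derivative_eval, Polynomial.sum_over_range' _ _ (N + 1) (by omega)]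
  · simp
  · simp

lemma coeff_sum2 (P : Polynomial ℝ) (N : ℕ) (h : P.natDegree ≤ N) :
    ∑ j ∈ range (N + 1), P.coeff j * (j * (j - 1)) = P.derivative.derivative.eval 1 := by
  have h1 : P.derivative.natDegree ≤ N := (Polynomial.natDegree_derivative_le P).trans (by omega)
  rw [← coeff_sum1 _ N h1, Finset.sum_range_succ' ,Finset.sum_range_succ]
  simp only [Polynomial.coeff_derivative]
  rw [Polynomial.coeff_eq_zero_of_natDegree_lt (show P.natDegree < N + 1 by omega)]
  simp only [zero_mul, add_zero, Nat.cast_zero, mul_zero]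
  refine Finset.sum_congr rfl fun j _ => ?_
  push_cast; ring

lemma eval_bp (a : ℝ) : (bp a).eval 1 = 1 := by simp [bp]
lemma der_bp (a : ℝ) : (bp a).derivative = Polynomial.C a := by simp [bp]

lemma pp_eval (a b : ℝ) (m l : ℕ) : ((bp a) ^ m * (bp b) ^ l).eval 1 = 1 := by
  simp [eval_bp]
lemma pp_der (a b : ℝ) (m l : ℕ) : ((bp a) ^ m * (bp b) ^ l).derivative.eval 1 = m * a + l * b := by
  simp [eval_bp, der_bp, Polynomial.derivative_mul, Polynomial.derivative_pow]
lemma pp_der2 (a b : ℝ) (m l : ℕ) :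
    ((bp a) ^ m * (bp b) ^ l).derivative.derivative.eval 1
      = m * (m - 1) * a ^ 2 + 2 * (m * a) * (l * b) + l * (l - 1) * b ^ 2 := by
  have h : ∀ n : ℕ, (n : ℝ) * ((n - 1 : ℕ) : ℝ) = n * (n - 1) := by
    intro n; cases n <;> simp
  simp [eval_bp, der_bp, Polynomial.derivative_mul, Polynomial.derivative_pow]
  linear_combination a ^ 2 * h m + b ^ 2 * h l

lemma barK_sum (N : ℕ) (ρ p : ℝ) (i : ℕ) (hi : i ≤ N) :
    ∑ j ∈ range (N + 1), barK N ρ p i j = 1 := by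
  simp only [barK_coeff N ρ p i _ hi]
  rw [coeff_sum0 _ _ ((natDegree_pp _ _ _ _).trans (by omega)), pp_eval]

lemma barK_mean (N : ℕ) (ρ p : ℝ) (i : ℕ) (hi : i ≤ N) :
    ∑ j ∈ range (N + 1), barK N ρ p i j * j = ρ * i + N * (p * (1 - ρ)) := by
  simp only [barK_coeff N ρ p i _ hi]
  rw [coeff_sum1 _ _ ((natDegree_pp _ _ _ _).trans (by omega)), pp_der]
  push_cast [hi]; ring

lemma barK_var (N : ℕ) (ρ p : ℝ) (i : ℕ) (hi : i ≤ N) :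
    ∑ j ∈ range (N + 1), barK N ρ p i j * (j - ρ * i - N * (p * (1 - ρ))) ^ 2 = sigmaSq N ρ p i := by
  have h0 := barK_sum N ρ p i hi
  have h1 := barK_mean N ρ p i hi
  have h2 := coeff_sum2 ((bp (p * (1 - ρ) + ρ)) ^ i * (bp (p * (1 - ρ))) ^ (N - i)) N
    ((natDegree_pp _ _ _ _).trans (by omega))
  simp only [← barK_coeff N ρ p i _ hi] at h2
  rw [pp_der2] at h2
  push_cast [hi] at h2
  have : ∀ j ∈ range (N + 1), barK N ρ p i j * ((j : ℝ) - ρ * i - N * (p * (1 - ρ))) ^ 2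
    = barK N ρ p i j * (j * (j - 1)) + (1 - 2 * (ρ * i + N * (p * (1 - ρ)))) * (barK N ρ p i j * j)
      + (ρ * i + N * (p * (1 - ρ))) ^ 2 * barK N ρ p i j := by
    intro j _; ring
  rw [Finset.sum_congr rfl this, Finset.sum_add_distrib, Finset.sum_add_distrib, ← Finset.mul_sum,
    ← Finset.mul_sum, h0, h1, h2]
  unfold sigmaSq
  ring

lemma binom_sum (N : ℕ) (p : ℝ) : ∑ j ∈ range (N + 1), binomPMF N p j = 1 := by
  have := coeff_sum0 _ _ (natDegree_pp p p N 0)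
  rw [pp_eval] at this
  simpa [binomPMF_coeff] using this
lemma binom_mean (N : ℕ) (p : ℝ) : ∑ j ∈ range (N + 1), binomPMF N p j * j = N * p := by
  have := coeff_sum1 _ _ (natDegree_pp p p N 0)
  rw [pp_der] at this
  simpa [binomPMF_coeff] using this
lemma binom_sq (N : ℕ) (p : ℝ) :
    ∑ j ∈ range (N + 1), binomPMF N p j * (j : ℝ) ^ 2 = N * p * (1 - p) + (N * p) ^ 2 := by
  have := coeff_sum2 _ _ (natDegree_pp p p N 0)
  rw [pp_der2] at this
  have h2 : ∑ j ∈ range (N + 1), binomPMF N p j * (j * ((j : ℝ) - 1)) = N * (N - 1) * p ^ 2 := by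
    simpa [binomPMF_coeff] using this
  have e : ∀ j ∈ range (N + 1), binomPMF N p j * (j : ℝ) ^ 2
    = binomPMF N p j * (j * ((j : ℝ) - 1)) + binomPMF N p j * j := by
    intro j _; ring
  rw [Finset.sum_congr rfl e, Finset.sum_add_distrib, h2, binom_mean]
  ring

lemma binom_inv (N : ℕ) (ρ p : ℝ) (j : ℕ) :
    ∑ i ∈ range (N + 1), binomPMF N p i * barK N ρ p i j = binomPMF N p j := by
  have key : (bp p) ^ N = ∑ i ∈ range (N + 1), Polynomial.C (binomPMF N p i) *
      ((bp (p * (1 - ρ) + ρ)) ^ i * (bp (p * (1 - ρ))) ^ (N - i)) := by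
    have : bp p = Polynomial.C p * bp (p * (1 - ρ) + ρ) + Polynomial.C (1 - p) * bp (p * (1 - ρ)) := by
      unfold bp
      simp only [map_sub, map_add, map_mul, map_one]
      ring
    rw [this, add_pow]
    refine Finset.sum_congr rfl fun i _ => ?_
    simp only [binomPMF, mul_pow, map_mul, map_pow, map_natCast]
    ring
  rw [binomPMF_coeff, key, Polynomial.finsetSum_coeff]
  refine Finset.sum_congr rfl fun i hi => ?_
  rw [Polynomial.coeff_C_mul, barK_coeff N ρ p i j (by simpa [Nat.lt_succ_iff] using hi)]

lemma barK_zero (N : ℕ) (ρ p : ℝ) (i j : ℕ) (hj : N < j) (hi : i ≤ N) : barK N ρ p i j = 0 := by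
  rw [barK_coeff N ρ p i j hi]
  exact Polynomial.coeff_eq_zero_of_natDegree_lt
    (lt_of_le_of_lt (natDegree_pp _ _ _ _) (by omega))

lemma barK_pos (N : ℕ) (ρ p : ℝ) (i j : ℕ) (hj : j ≤ N) (hi : i ≤ N)
    (hb0 : 0 < p * (1 - ρ)) (hb1 : p * (1 - ρ) < 1) (ha0 : 0 < p * (1 - ρ) + ρ)
    (ha1 : p * (1 - ρ) + ρ < 1) : 0 < barK N ρ p i j := by
  unfold barK
  refine Finset.sum_pos (fun m hm => ?_) ⟨min i j, ?_⟩
  · rw [Finset.mem_Icc, le_min_iff] at hm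
    have h1 : (0 : ℝ) < Nat.choose i m := by exact_mod_cast Nat.choose_pos hm.2.1
    have h2 : (0 : ℝ) < Nat.choose (N - i) (j - m) := by exact_mod_cast Nat.choose_pos (by omega)
    have h3 := sub_pos.2 hb1
    have h4 := sub_pos.2 ha1
    positivity
  · rw [Finset.mem_Icc]
    omega

section Chain

structure IsBarChain (N : ℕ) (π0 : ℕ → ℝ) (k : ℕ → ℕ → ℝ) (μ : Measure (ℕ → ℕ)) : Prop where
  pi_nonneg : ∀ i ≤ N, 0 ≤ π0 i
  pi_zero : ∀ i, N < i → π0 i = 0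
  k_pos : ∀ i ≤ N, ∀ j ≤ N, 0 < k i j
  k_zero : ∀ i ≤ N, ∀ j, N < j → k i j = 0
  k_sum : ∀ i ≤ N, ∑ j ∈ range (N + 1), k i j = 1
  pi_sum : ∑ i ∈ range (N + 1), π0 i = 1
  pi_inv : ∀ j ≤ N, ∑ i ∈ range (N + 1), π0 i * k i j = π0 j
  cyl : ∀ (n : ℕ) (x : ℕ → ℕ),
      μ {ω | ∀ t ≤ n, ω t = x t} =
        ENNReal.ofReal (π0 (x 0) * ∏ t ∈ Finset.Icc 1 n, k (x (t - 1)) (x t))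

variable {N : ℕ} {π0 : ℕ → ℝ} {k : ℕ → ℕ → ℝ} {μ : Measure (ℕ → ℕ)}

lemma IsBarChain.weight_zero (h : IsBarChain N π0 k μ) (x : ℕ → ℕ) (n : ℕ)
    (hx : ¬ ∀ t ≤ n, x t ≤ N) :
    π0 (x 0) * ∏ t ∈ Finset.Icc 1 n, k (x (t - 1)) (x t) = 0 := by
  induction n with
  | zero =>
    simp only [Nat.le_zero_eq, forall_eq, not_le] at hx
    simp [h.pi_zero _ hx]
  | succ n ih =>
    rw [Finset.prod_Icc_succ_top (by omega), ← mul_assoc]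
    by_cases h1 : ∀ t ≤ n, x t ≤ N
    · have : N < x (n + 1) := by
        by_contra hc
        apply hx
        intro t ht
        rcases Nat.lt_or_ge n t with h2 | h2
        · have : t = n + 1 := by omega
          subst this; omega
        · exact h1 t h2
      have h3 := h.k_zero (x n) (h1 n le_rfl) _ this
      simp [h3]
    · rw [ih h1, zero_mul]

def extPre {α : Type*} (n : ℕ) (c : α → ℕ) (x : Fin (n + 1) → α) : ℕ → ℕ :=
  fun t => if h : t < n + 1 then c (x ⟨t, h⟩) else 0

lemma IsBarChain.ae_le (h : IsBarChain N π0 k μ) : ∀ᵐ ω ∂μ, ∀ t, ω t ≤ N := by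
  rw [ae_all_iff]
  intro t
  rw [ae_iff]
  have hsub : {ω : ℕ → ℕ | ¬ ω t ≤ N} ⊆ ⋃ x : Fin (t + 1) → ℕ,
      {ω | (∀ s ≤ t, ω s = extPre t id x s) ∧ ¬ extPre t id x t ≤ N} := by
    intro ω hω
    simp only [Set.mem_iUnion]
    refine ⟨fun s => ω s, ?_, ?_⟩
    · intro s hs
      simp [extPre, Nat.lt_succ_of_le hs]
    · simpa [extPre] using hω
  refine measure_mono_null hsub (measure_iUnion_null fun x => ?_)
  by_cases hx : extPre t id x t ≤ N
  · simp [hx]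
  · simp only [hx, not_false_eq_true, and_true]
    rw [h.cyl, h.weight_zero _ _ (fun hh => hx (hh t le_rfl))]
    simp

lemma measurableSet_cyl (n : ℕ) (x : ℕ → ℕ) : MeasurableSet {ω : ℕ → ℕ | ∀ t ≤ n, ω t = x t} := by
  have : {ω : ℕ → ℕ | ∀ t ≤ n, ω t = x t} = ⋂ t, ⋂ (_ : t ≤ n), (fun ω : ℕ → ℕ => ω t) ⁻¹' {x t} := by
    ext; simp
  rw [this]
  exact MeasurableSet.iInter fun t => MeasurableSet.iInter fun _ =>
    (measurable_pi_apply t) (measurableSet_singleton _)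

def weight (π0 : ℕ → ℝ) (k : ℕ → ℕ → ℝ) (n : ℕ) (x : ℕ → ℕ) : ℝ :=
  π0 (x 0) * ∏ t ∈ Finset.Icc 1 n, k (x (t - 1)) (x t)

lemma IsBarChain.real_cyl (h : IsBarChain N π0 k μ) (n : ℕ) (x : ℕ → ℕ) :
    μ.real {ω | ∀ t ≤ n, ω t = x t} = weight π0 k n x := by
  rw [Measure.real, h.cyl, weight, ENNReal.toReal_ofReal]
  by_cases hx : ∀ t ≤ n, x t ≤ N
  · refine mul_nonneg (h.pi_nonneg _ (hx 0 (by omega))) (Finset.prod_nonneg fun t ht => ?_)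
    rw [Finset.mem_Icc] at ht
    exact (h.k_pos _ (hx _ (by omega)) _ (hx _ (by omega))).le
  · rw [h.weight_zero _ _ hx]

def DepUpTo {E : Type*} (n : ℕ) (F : (ℕ → ℕ) → E) : Prop :=
  ∀ ω ω' : ℕ → ℕ, (∀ t ≤ n, ω t = ω' t) → F ω = F ω'

abbrev ext' (N n : ℕ) (x : Fin (n + 1) → Fin (N + 1)) : ℕ → ℕ :=
  extPre n (fun i : Fin (N + 1) => (i : ℕ)) x

lemma ext_le (N n : ℕ) (x : Fin (n + 1) → Fin (N + 1)) (t : ℕ) : ext' N n x t ≤ N := by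
  unfold ext' extPre
  split_ifs
  · exact Nat.le_of_lt_succ (x ⟨t, by assumption⟩).2
  · omega

lemma sum_ind {E : Type*} [AddCommMonoid E] (n : ℕ) (ω : ℕ → ℕ) (hω : ∀ t, ω t ≤ N)
    (H : (Fin (n + 1) → Fin (N + 1)) → E) :
    ∑ x : Fin (n + 1) → Fin (N + 1),
      ({ω | ∀ t ≤ n, ω t = ext' N n x t} : Set (ℕ → ℕ)).indicator (fun _ => H x) ω
      = H (fun t => ⟨ω t, Nat.lt_succ_of_le (hω t)⟩) := by
  rw [Finset.sum_eq_single (fun t : Fin (n + 1) => (⟨ω t, Nat.lt_succ_of_le (hω t)⟩ : Fin (N + 1)))]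
  · rw [Set.indicator_of_mem]
    intro t ht
    simp [ext', extPre, Nat.lt_succ_of_le ht]
  · intro x _ hx
    rw [Set.indicator_of_notMem]
    intro hmem
    apply hx
    ext t
    have := hmem t (Nat.le_of_lt_succ t.2)
    simp only [ext', extPre, t.2, dite_true] at this
    simp [this]
  · simp

lemma ext_eq (n : ℕ) (ω : ℕ → ℕ) (hω : ∀ t, ω t ≤ N) :
    ∀ t ≤ n, ext' N n (fun t => ⟨ω t, Nat.lt_succ_of_le (hω t)⟩) t = ω t := by
  intro t ht
  simp [ext', extPre, Nat.lt_succ_of_le ht]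

section
variable {E : Type*} [NormedAddCommGroup E]

lemma IsBarChain.expand_ae (h : IsBarChain N π0 k μ) (n : ℕ) (H : (ℕ → ℕ) → E) (hH : DepUpTo n H) :
    H =ᵐ[μ] fun ω => ∑ x : Fin (n + 1) → Fin (N + 1),
      ({ω | ∀ t ≤ n, ω t = ext' N n x t} : Set (ℕ → ℕ)).indicator (fun _ => H (ext' N n x)) ω := by
  filter_upwards [h.ae_le] with ω hω
  rw [sum_ind n ω hω (fun x => H (ext' N n x))]
  exact hH _ _ fun t ht => (ext_eq n ω hω t ht).symm

lemma IsBarChain.integrable [IsProbabilityMeasure μ] (h : IsBarChain N π0 k μ) {n : ℕ}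
    {H : (ℕ → ℕ) → E} (hH : DepUpTo n H) : Integrable H μ := by
  refine Integrable.congr ?_ (h.expand_ae n H hH).symm
  refine integrable_finsetSum _ fun x _ => ?_
  exact (integrable_const _).indicator (measurableSet_cyl _ _)

lemma IsBarChain.markov [IsProbabilityMeasure μ] (h : IsBarChain N π0 k μ) {n : ℕ}
    {F : (ℕ → ℕ) → ℂ} (hF : DepUpTo n F) (g : ℕ → ℕ → ℂ) :
    ∫ ω, F ω * g (ω n) (ω (n + 1)) ∂μ =
      ∫ ω, F ω * ∑ j ∈ range (N + 1), (k (ω n) j : ℂ) * g (ω n) j ∂μ := by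
  have hR : DepUpTo n (fun ω : ℕ → ℕ => F ω * ∑ j ∈ range (N + 1), (k (ω n) j : ℂ) * g (ω n) j) := by
    intro ω ω' hh
    simp only [hF ω ω' hh, hh n le_rfl]
  rw [integral_congr_ae (h.expand_ae n _ hR)]
  have hL : (fun ω : ℕ → ℕ => F ω * g (ω n) (ω (n + 1))) =ᵐ[μ] fun ω =>
      ∑ x : Fin (n + 1) → Fin (N + 1), ∑ j ∈ range (N + 1),
      ({ω | ∀ t ≤ n + 1, ω t = Function.update (ext' N n x) (n + 1) j t} : Set (ℕ → ℕ)).indicator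
        (fun _ => F (ext' N n x) * g (ext' N n x n) j) ω := by
    filter_upwards [h.ae_le] with ω hω
    have : ∀ x : Fin (n + 1) → Fin (N + 1), ∑ j ∈ range (N + 1),
      ({ω | ∀ t ≤ n + 1, ω t = Function.update (ext' N n x) (n + 1) j t} : Set (ℕ → ℕ)).indicator
        (fun _ => F (ext' N n x) * g (ext' N n x n) j) ω = 
        ({ω | ∀ t ≤ n, ω t = ext' N n x t} : Set (ℕ → ℕ)).indicator
        (fun _ => F (ext' N n x) * g (ext' N n x n) (ω (n + 1))) ω := by
      intro x
      rw [Finset.sum_eq_single (ω (n + 1))]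
      · simp only [Set.indicator_apply, Set.mem_ofPred_eq]
        congr 1
        apply propext
        constructor
        · intro hh t ht
          have := hh t (by omega)
          rwa [Function.update_of_ne (by omega)] at this
        · intro hh t ht
          rcases Nat.lt_or_ge n t with h2 | h2
          · have : t = n + 1 := by omega
            subst this; simp
          · rw [Function.update_of_ne (by omega)]
            exact hh t h2
      · intro j _ hj
        rw [Set.indicator_of_notMem]
        intro hmem
        have := hmem (n + 1) le_rfl
        simp at this
        exact hj this.symm
      · intro hh
        exact absurd (Finset.mem_range.2 (Nat.lt_succ_of_le (hω _))) hh
    simp only [this]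
    rw [sum_ind n ω hω (fun x => F (ext' N n x) * g (ext' N n x n) (ω (n + 1)))]
    rw [ext_eq n ω hω n le_rfl, hF _ _ (ext_eq n ω hω)]
  rw [integral_congr_ae hL, integral_finsetSum _ fun x _ => ?_, integral_finsetSum _ fun x _ => ?_]
  · refine Finset.sum_congr rfl fun x _ => ?_
    rw [integral_finsetSum _ fun j _ => ?_, integral_indicator_const _ (measurableSet_cyl _ _),
      h.real_cyl, Finset.mul_sum, Finset.smul_sum]
    · refine Finset.sum_congr rfl fun j _ => ?_
      rw [integral_indicator_const _ (measurableSet_cyl _ _), h.real_cyl]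
      have : weight π0 k (n + 1) (Function.update (ext' N n x) (n + 1) j)
        = weight π0 k n (ext' N n x) * k (ext' N n x n) j := by
        unfold weight
        rw [Finset.prod_Icc_succ_top (by omega), ← mul_assoc]
        congr 1
        · rw [Function.update_of_ne (by omega)]
          congr 1
          refine Finset.prod_congr rfl fun t ht => ?_
          rw [Finset.mem_Icc] at ht
          rw [Function.update_of_ne (by omega), Function.update_of_ne (by omega)]
        · simp
      rw [this]
      simp only [Complex.real_smul]
      push_cast
      ring
    · exact (integrable_const _).indicator (measurableSet_cyl _ _)
  · exact (integrable_const _).indicator (measurableSet_cyl _ _)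
  · refine integrable_finsetSum _ fun j _ => ?_
    exact (integrable_const _).indicator (measurableSet_cyl _ _)

end

lemma IsBarChain.orth [IsProbabilityMeasure μ] (h : IsBarChain N π0 k μ) {n : ℕ}
    {F : (ℕ → ℕ) → ℝ} (hF : DepUpTo n F) (d : ℕ → ℕ → ℝ)
    (hd : ∀ i ≤ N, ∑ j ∈ range (N + 1), k i j * d i j = 0) :
    ∫ ω, F ω * d (ω n) (ω (n + 1)) ∂μ = 0 := by
  have hF' : DepUpTo n (fun ω => (F ω : ℂ)) := by
    intro ω ω' hh
    simp only [hF ω ω' hh]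
  have := h.markov hF' (fun i j => (d i j : ℂ))
  have h2 : ∫ ω, (F ω : ℂ) * ∑ j ∈ range (N + 1), (k (ω n) j : ℂ) * (d (ω n) j : ℂ) ∂μ = 0 := by
    rw [integral_congr_ae (g := fun _ => 0)]
    · simp
    · filter_upwards [h.ae_le] with ω hω
      have := hd (ω n) (hω n)
      have h3 : ∑ j ∈ range (N + 1), (k (ω n) j : ℂ) * (d (ω n) j : ℂ) = 0 := by
        exact_mod_cast congrArg (fun x : ℝ => (x : ℂ)) this
      rw [h3, mul_zero]
  rw [h2] at this
  have h4 : ∫ ω, ((F ω * d (ω n) (ω (n + 1)) : ℝ) : ℂ) ∂μ = 0 := by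
    rw [← this]
    simp
  rw [integral_complex_ofReal] at h4
  exact_mod_cast h4

/-- Partial sums of an additive functional of the chain transitions. -/
def psum (d : ℕ → ℕ → ℝ) (n : ℕ) (ω : ℕ → ℕ) : ℝ := ∑ t ∈ range n, d (ω t) (ω (t + 1))

lemma dep_psum (d : ℕ → ℕ → ℝ) (n : ℕ) : DepUpTo n (psum d n) := by
  intro ω ω' hh
  unfold psum
  refine Finset.sum_congr rfl fun t ht => ?_
  rw [Finset.mem_range] at ht
  rw [hh t (by omega), hh (t + 1) (by omega)]

lemma IsBarChain.mart_sq [IsProbabilityMeasure μ] (h : IsBarChain N π0 k μ)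
    (d : ℕ → ℕ → ℝ) (hd : ∀ i ≤ N, ∑ j ∈ range (N + 1), k i j * d i j = 0)
    (B : ℝ) (hB : ∀ i ≤ N, ∀ j ≤ N, |d i j| ≤ B) (n : ℕ) :
    ∫ ω, (psum d n ω) ^ 2 ∂μ ≤ n * B ^ 2 := by
  induction n with
  | zero => simp [psum]
  | succ n ih =>
    have e : ∀ ω, (psum d (n + 1) ω) ^ 2 = (psum d n ω) ^ 2
        + (2 * psum d n ω) * d (ω n) (ω (n + 1)) + (d (ω n) (ω (n + 1))) ^ 2 := by
      intro ω
      simp only [psum, Finset.sum_range_succ]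
      ring
    simp only [e]
    have d1 : DepUpTo n (fun ω => (psum d n ω) ^ 2) := fun ω ω' hh => by
      simp only [dep_psum d n ω ω' hh]
    have d2' : DepUpTo n (fun ω => 2 * psum d n ω) := fun ω ω' hh => by
      simp only [dep_psum d n ω ω' hh]
    have d2 : DepUpTo (n + 1) (fun ω => (2 * psum d n ω) * d (ω n) (ω (n + 1))) := fun ω ω' hh => by
      simp only [dep_psum d n ω ω' (fun t ht => hh t (by omega)), hh n (by omega), hh (n + 1) le_rfl]
    have d3 : DepUpTo (n + 1) (fun ω => (d (ω n) (ω (n + 1))) ^ 2) := fun ω ω' hh => by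
      simp only [hh n (by omega), hh (n + 1) le_rfl]
    have i1 := h.integrable d1
    have i2 := h.integrable d2
    have i3 := h.integrable d3
    rw [integral_add (f := fun ω => psum d n ω ^ 2 + (2 * psum d n ω) * d (ω n) (ω (n + 1)))
      (i1.add i2) i3, integral_add i1 i2, h.orth d2' d hd]
    have : ∫ ω, (d (ω n) (ω (n + 1))) ^ 2 ∂μ ≤ B ^ 2 := by
      calc ∫ ω, (d (ω n) (ω (n + 1))) ^ 2 ∂μ ≤ ∫ ω, B ^ 2 ∂μ := by
            refine integral_mono_ae i3 (integrable_const _) ?_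
            filter_upwards [h.ae_le] with ω hω
            exact sq_le_sq.2 ((hB _ (hω _) _ (hω _)).trans (le_abs_self B))
        _ = B ^ 2 := by simp
    push_cast
    linarith

lemma IsBarChain.poisson (h : IsBarChain N π0 k μ) (f : ℕ → ℝ) :
    ∃ g : ℕ → ℝ, ∀ i ≤ N, g i - ∑ j ∈ range (N + 1), k i j * g j
      = f i - ∑ j ∈ range (N + 1), π0 j * f j := by
  let L : (Fin (N + 1) → ℝ) →ₗ[ℝ] (Fin (N + 1) → ℝ) :=
    { toFun := fun g i => g i - ∑ j : Fin (N + 1), k i j * g j + ∑ j : Fin (N + 1), π0 j * g j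
      map_add' := by
        intro a b
        ext i
        simp only [Pi.add_apply, mul_add, Finset.sum_add_distrib]
        ring
      map_smul' := by
        intro c a
        ext i
        simp only [Pi.smul_apply, smul_eq_mul, RingHom.id_apply, mul_add, mul_sub, Finset.mul_sum,
          mul_left_comm c] }
  have hL : ∀ g i, L g i = g i - ∑ j : Fin (N + 1), k i j * g j + ∑ j : Fin (N + 1), π0 j * g j :=
    fun g i => rfl
  have hps : ∑ i : Fin (N + 1), π0 i = 1 := by
    rw [← h.pi_sum, Finset.sum_range]
  have hks : ∀ i : Fin (N + 1), ∑ j : Fin (N + 1), k i j = 1 := by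
    intro i
    rw [← h.k_sum i (Nat.le_of_lt_succ i.2), Finset.sum_range]
  have hpi : ∀ j : Fin (N + 1), ∑ i : Fin (N + 1), π0 i * k i j = π0 j := by
    intro j
    rw [← h.pi_inv j (Nat.le_of_lt_succ j.2), Finset.sum_range]
  -- applying π to L g gives π g
  have hLpi : ∀ g, ∑ i : Fin (N + 1), π0 i * L g i = ∑ j : Fin (N + 1), π0 j * g j := by
    intro g
    simp only [hL, mul_add, mul_sub, Finset.sum_add_distrib, Finset.sum_sub_distrib]
    rw [← Finset.sum_mul, hps]
    have : ∑ i : Fin (N + 1), π0 i * ∑ j : Fin (N + 1), k i j * g j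
        = ∑ j : Fin (N + 1), π0 j * g j := by
      simp only [Finset.mul_sum]
      rw [Finset.sum_comm]
      refine Finset.sum_congr rfl fun j _ => ?_
      rw [← hpi j, Finset.sum_mul]
      refine Finset.sum_congr rfl fun i _ => ?_
      ring
    rw [this]; ring
  have hinj : Function.Injective L := by
    rw [← LinearMap.ker_eq_bot, LinearMap.ker_eq_bot']
    intro g hg
    have h0 : ∑ j : Fin (N + 1), π0 j * g j = 0 := by
      rw [← hLpi, hg]; simp
    obtain ⟨i0, hi0⟩ := Finite.exists_max g
    have h1 := hL g i0
    rw [hg, h0] at h1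
    have h2 : ∑ j : Fin (N + 1), k i0 j * (g i0 - g j) = 0 := by
      simp only [mul_sub, Finset.sum_sub_distrib]
      rw [← Finset.sum_mul, hks]
      simp at h1
      linarith
    rw [Finset.sum_eq_zero_iff_of_nonneg] at h2
    · have h3 : ∀ j, g j = g i0 := by
        intro j
        have h4 := h2 j (Finset.mem_univ _)
        have h5 := h.k_pos i0 (Nat.le_of_lt_succ i0.2) j (Nat.le_of_lt_succ j.2)
        rcases mul_eq_zero.1 h4 with h6 | h6
        · exact absurd h6 h5.ne'
        · linarith
      simp only [h3] at h0
      rw [← Finset.sum_mul, hps, one_mul] at h0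
      ext j
      rw [h3, h0]; rfl
    · intro j _
      exact mul_nonneg (h.k_pos i0 (Nat.le_of_lt_succ i0.2) j (Nat.le_of_lt_succ j.2)).le
        (sub_nonneg.2 (hi0 j))
  have hsurj := LinearMap.injective_iff_surjective.1 hinj
  obtain ⟨g, hg⟩ := hsurj (fun i => f i - ∑ j ∈ range (N + 1), π0 j * f j)
  have h0 : ∑ j : Fin (N + 1), π0 j * g j = 0 := by
    rw [← hLpi, hg]
    simp only [mul_sub, Finset.sum_sub_distrib]
    rw [← Finset.sum_mul, hps, Finset.sum_range]
    ring
  refine ⟨fun i => if hi : i < N + 1 then g ⟨i, hi⟩ else 0, fun i hi => ?_⟩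
  have h1 := congrFun hg ⟨i, Nat.lt_succ_of_le hi⟩
  rw [hL, h0] at h1
  rw [Finset.sum_range]
  simp only [Nat.lt_succ_of_le hi, dite_true, Fin.is_lt, Fin.eta]
  simp only at h1
  linarith

lemma exists_bound1 (N : ℕ) (g : ℕ → ℝ) : ∃ B, 0 ≤ B ∧ ∀ i ≤ N, |g i| ≤ B := by
  refine ⟨∑ i ∈ range (N + 1), |g i|, Finset.sum_nonneg fun _ _ => abs_nonneg _, fun i hi => ?_⟩
  exact Finset.single_le_sum (f := fun i => |g i|) (fun _ _ => abs_nonneg _)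
    (Finset.mem_range.2 (Nat.lt_succ_of_le hi))

lemma exists_bound2 (N : ℕ) (d : ℕ → ℕ → ℝ) : ∃ B, 0 ≤ B ∧ ∀ i ≤ N, ∀ j ≤ N, |d i j| ≤ B := by
  choose B hB0 hB using fun i => exists_bound1 N (d i)
  obtain ⟨C, hC0, hC⟩ := exists_bound1 N B
  exact ⟨C, hC0, fun i hi j hj => (hB i j hj).trans ((le_abs_self _).trans (hC i hi))⟩

lemma IsBarChain.lln_sq [IsProbabilityMeasure μ] (h : IsBarChain N π0 k μ) (f : ℕ → ℝ) :
    ∃ C : ℝ, 0 ≤ C ∧ ∀ n : ℕ, ∫ ω, (psum (fun i _ => f i) n ω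
      - n * ∑ j ∈ range (N + 1), π0 j * f j) ^ 2 ∂μ ≤ C * (n + 1) := by
  obtain ⟨g, hg⟩ := h.poisson f
  set m := ∑ j ∈ range (N + 1), π0 j * f j with hm
  set d : ℕ → ℕ → ℝ := fun i j => g j - ∑ l ∈ range (N + 1), k i l * g l with hd
  obtain ⟨B, hB0, hB⟩ := exists_bound2 N d
  obtain ⟨A, hA0, hA⟩ := exists_bound1 N g
  have hd0 : ∀ i ≤ N, ∑ j ∈ range (N + 1), k i j * d i j = 0 := by
    intro i hi
    simp only [hd, mul_sub, Finset.sum_sub_distrib]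
    rw [← Finset.sum_mul, h.k_sum i hi]
    ring
  refine ⟨8 * A ^ 2 + 2 * B ^ 2, by positivity, fun n => ?_⟩
  have key : ∀ᵐ ω ∂μ, (psum (fun i _ => f i) n ω - n * m) ^ 2
      ≤ 8 * A ^ 2 + 2 * (psum d n ω) ^ 2 := by
    filter_upwards [h.ae_le] with ω hω
    have e : psum (fun i _ => f i) n ω - n * m = psum d n ω + (g (ω 0) - g (ω n)) := by
      unfold psum
      induction n with
      | zero => simp
      | succ n ih =>
        rw [Finset.sum_range_succ, Finset.sum_range_succ]
        have := hg (ω n) (hω n)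
        simp only [hd] at ih ⊢
        push_cast
        linarith
    rw [e]
    have h1 := abs_le.1 (hA _ (hω 0))
    have h2 := abs_le.1 (hA _ (hω n))
    have h3 : (g (ω 0) - g (ω n)) ^ 2 ≤ (2 * A) ^ 2 :=
      sq_le_sq' (by linarith [h1.1, h2.2]) (by linarith [h1.2, h2.1])
    nlinarith [sq_nonneg (psum d n ω - (g (ω 0) - g (ω n)))]
  have i1 : Integrable (fun ω => (psum d n ω) ^ 2) μ :=
    h.integrable (n := n) (fun ω ω' hh => by simp only [dep_psum d n ω ω' hh])
  have i2 : Integrable (fun ω => (psum (fun i _ => f i) n ω - n * m) ^ 2) μ :=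
    h.integrable (n := n) (fun ω ω' hh => by simp only [dep_psum (fun i _ => f i) n ω ω' hh])
  have := integral_mono_ae i2 ((integrable_const (8 * A ^ 2)).add (i1.const_mul 2)) key
  refine this.trans ?_
  simp only [Pi.add_apply]
  rw [integral_add (integrable_const _) (i1.const_mul 2)]
  have h5 := h.mart_sq d hd0 B hB n
  simp only [integral_const, integral_const_mul, probReal_univ, one_smul]
  have : (0:ℝ) ≤ n := Nat.cast_nonneg n
  nlinarith [mul_nonneg this (sq_nonneg A), sq_nonneg B]

lemma tendsto_isqrt : Tendsto (fun n : ℕ => (Real.sqrt n)⁻¹) atTop (nhds 0) :=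
  tendsto_inv_atTop_zero.comp (Real.tendsto_sqrt_atTop.comp tendsto_natCast_atTop_atTop)

lemma isqrt_sq (n : ℕ) (hn : 1 ≤ n) : ((Real.sqrt n)⁻¹) ^ 2 * n = 1 := by
  have : (0 : ℝ) < n := by exact_mod_cast hn
  rw [inv_pow, Real.sq_sqrt this.le]
  field_simp

lemma isqrt_le_one (n : ℕ) (hn : 1 ≤ n) : (Real.sqrt n)⁻¹ ≤ 1 := by
  have : (1 : ℝ) ≤ n := by exact_mod_cast hn
  exact inv_le_one_of_one_le₀ (Real.one_le_sqrt.2 this)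

lemma step_bound (M : ℕ) (w ξ : ℕ → ℝ) (v B s : ℝ) (hs0 : 0 ≤ s) (hs1 : s ≤ 1)
    (hw : ∀ j ∈ range M, 0 ≤ w j) (hw1 : ∑ j ∈ range M, w j = 1)
    (hξ : ∀ j ∈ range M, |ξ j| ≤ B) (hv0 : 0 ≤ v) (hvB : v ≤ B)
    (h1 : ∑ j ∈ range M, w j * ξ j = 0) (h2 : ∑ j ∈ range M, w j * ξ j ^ 2 = v) :
    ‖∑ j ∈ range M, (w j : ℂ) *
      (Complex.exp (Complex.I * ((s * ξ j : ℝ) : ℂ) + ((s ^ 2 / 2 * v : ℝ) : ℂ)) - 1)‖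
      ≤ ((2 * B) ^ 3 * Real.exp (2 * B) + B ^ 2) * s ^ 3 := by
  have hB0 : 0 ≤ B := hv0.trans hvB
  set z : ℕ → ℂ := fun j => Complex.I * ((s * ξ j : ℝ) : ℂ) + ((s ^ 2 / 2 * v : ℝ) : ℂ) with hz
  have hzn : ∀ j ∈ range M, ‖z j‖ ≤ 2 * B * s := by
    intro j hj
    refine (norm_add_le _ _).trans ?_
    rw [norm_mul, Complex.norm_I, one_mul, Complex.norm_real, Complex.norm_real, Real.norm_eq_abs,
      Real.norm_eq_abs, abs_mul, abs_of_nonneg hs0, abs_of_nonneg (by positivity : 0 ≤ s ^ 2 / 2 * v)]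
    have e1 : s * |ξ j| ≤ s * B := mul_le_mul_of_nonneg_left (hξ j hj) hs0
    have e2 : s ^ 2 / 2 * v ≤ s * B := by
      have : s ^ 2 / 2 ≤ s := by nlinarith
      exact mul_le_mul this hvB hv0 hs0
    linarith
  have hsplit : ∑ j ∈ range M, (w j : ℂ) * (Complex.exp (z j) - 1)
      = ∑ j ∈ range M, (w j : ℂ) * (Complex.exp (z j) - ∑ m ∈ range 3, (z j) ^ m / (m.factorial : ℂ))
        + ((s ^ 4 * v ^ 2 / 8 : ℝ) : ℂ) := by
    have e : ∑ j ∈ range M, (w j : ℂ) * (z j + z j ^ 2 / 2) = ((s ^ 4 * v ^ 2 / 8 : ℝ) : ℂ) := by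
      have h1' : ∑ j ∈ range M, (w j : ℂ) * (ξ j : ℂ) = 0 := by
        exact_mod_cast congrArg (fun x : ℝ => (x : ℂ)) h1
      have h2' : ∑ j ∈ range M, (w j : ℂ) * (ξ j : ℂ) ^ 2 = (v : ℂ) := by
        exact_mod_cast congrArg (fun x : ℝ => (x : ℂ)) h2
      have h3' : ∑ j ∈ range M, (w j : ℂ) = 1 := by
        exact_mod_cast congrArg (fun x : ℝ => (x : ℂ)) hw1
      have : ∀ j ∈ range M, (w j : ℂ) * (z j + z j ^ 2 / 2)
          = (Complex.I * s + Complex.I * s ^ 3 * v / 2) * ((w j : ℂ) * (ξ j : ℂ))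
            - (s : ℂ) ^ 2 / 2 * ((w j : ℂ) * (ξ j : ℂ) ^ 2)
            + ((s : ℂ) ^ 2 / 2 * v + s ^ 4 * v ^ 2 / 8) * (w j : ℂ) := by
        intro j _
        simp only [hz]
        push_cast
        linear_combination ((w j : ℂ) * s ^ 2 * ξ j ^ 2 / 2) * Complex.I_sq
      rw [Finset.sum_congr rfl this, Finset.sum_add_distrib, Finset.sum_sub_distrib,
        ← Finset.mul_sum, ← Finset.mul_sum, ← Finset.mul_sum, h1', h2', h3']
      push_cast
      ring
    rw [← e, ← Finset.sum_add_distrib]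
    refine Finset.sum_congr rfl fun j _ => ?_
    simp [Finset.sum_range_succ, Nat.factorial]
    ring
  change ‖∑ j ∈ range M, (w j : ℂ) * (Complex.exp (z j) - 1)‖ ≤ _
  rw [hsplit]
  refine (norm_add_le _ _).trans ?_
  rw [add_mul]
  refine add_le_add ?_ ?_
  · refine (norm_sum_le _ _).trans ?_
    calc ∑ j ∈ range M, ‖(w j : ℂ) * (Complex.exp (z j) - ∑ m ∈ range 3, (z j) ^ m / (m.factorial : ℂ))‖
        ≤ ∑ j ∈ range M, w j * ((2 * B) ^ 3 * Real.exp (2 * B) * s ^ 3) := by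
          refine Finset.sum_le_sum fun j hj => ?_
          rw [norm_mul, Complex.norm_real, Real.norm_eq_abs, abs_of_nonneg (hw j hj)]
          refine mul_le_mul_of_nonneg_left ?_ (hw j hj)
          refine (Complex.norm_exp_sub_sum_le_norm_mul_exp (z j) 3).trans ?_
          have e1 := hzn j hj
          have e2 : ‖z j‖ ^ 3 ≤ (2 * B * s) ^ 3 := pow_le_pow_left₀ (norm_nonneg _) e1 3
          have e3 : Real.exp ‖z j‖ ≤ Real.exp (2 * B) :=
            Real.exp_le_exp.2 (e1.trans (by nlinarith))
          calc ‖z j‖ ^ 3 * Real.exp ‖z j‖ ≤ (2 * B * s) ^ 3 * Real.exp (2 * B) :=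
                mul_le_mul e2 e3 (Real.exp_pos _).le (by positivity)
            _ = _ := by ring
      _ = _ := by rw [← Finset.sum_mul, hw1, one_mul]
  · rw [Complex.norm_real, Real.norm_eq_abs, abs_of_nonneg (by positivity)]
    have e1 : v ^ 2 ≤ B ^ 2 := pow_le_pow_left₀ hv0 hvB 2
    have e2 : s ^ 4 ≤ s ^ 3 := pow_le_pow_of_le_one hs0 hs1 (by norm_num)
    have e3 : s ^ 4 * v ^ 2 ≤ s ^ 3 * B ^ 2 := mul_le_mul e2 e1 (sq_nonneg _) (by positivity)
    have e4 : 0 ≤ s ^ 4 * v ^ 2 := by positivity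
    linarith

lemma IsBarChain.lln_L1 [IsProbabilityMeasure μ] (h : IsBarChain N π0 k μ) (f : ℕ → ℝ) :
    Tendsto (fun n : ℕ => ∫ ω, |psum (fun i _ => f i) n ω / n
      - ∑ j ∈ range (N + 1), π0 j * f j| ∂μ) atTop (nhds 0) := by
  obtain ⟨C, hC0, hC⟩ := h.lln_sq f
  set m := ∑ j ∈ range (N + 1), π0 j * f j with hm
  have hlim : Tendsto (fun n : ℕ => (1 / 2 + C) * (Real.sqrt n)⁻¹) atTop (nhds 0) := by
    simpa using tendsto_isqrt.const_mul (1 / 2 + C)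
  refine squeeze_zero' (Eventually.of_forall fun n => integral_nonneg fun ω => abs_nonneg _) ?_ hlim
  filter_upwards [eventually_ge_atTop 1] with n hn
  set s := (Real.sqrt n)⁻¹ with hs
  have hs0 : 0 ≤ s := by positivity
  have hsn : s ^ 2 * n = 1 := isqrt_sq n hn
  have hnpos : (1 : ℝ) ≤ n := by exact_mod_cast hn
  have i1 : Integrable (fun ω => |psum (fun i _ => f i) n ω / n - m|) μ :=
    h.integrable (n := n) (fun ω ω' hh => by simp only [dep_psum (fun i _ => f i) n ω ω' hh])
  have i2 : Integrable (fun ω => (psum (fun i _ => f i) n ω - n * m) ^ 2) μ :=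
    h.integrable (n := n) (fun ω ω' hh => by simp only [dep_psum (fun i _ => f i) n ω ω' hh])
  have hb : ∀ ω, |psum (fun i _ => f i) n ω / n - m| ≤
      s / 2 + s ^ 3 / 2 * (psum (fun i _ => f i) n ω - n * m) ^ 2 := by
    intro ω
    have e : psum (fun i _ => f i) n ω / n - m = s ^ 2 * (psum (fun i _ => f i) n ω - n * m) := by
      field_simp
      linear_combination -(psum (fun i _ => f i) n ω - n * m) * hsn
    rw [e, abs_mul, abs_of_nonneg (sq_nonneg s)]
    set S := psum (fun i _ => f i) n ω - n * m
    have := sq_abs S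
    have h9 := mul_nonneg hs0 (sq_nonneg (s * |S| - 1))
    have h10 : s * (s * |S| - 1) ^ 2 = s ^ 3 * |S| ^ 2 - 2 * (s ^ 2 * |S|) + s := by ring
    rw [h10, this] at h9
    linarith
  calc ∫ ω, |psum (fun i _ => f i) n ω / n - m| ∂μ
      ≤ ∫ ω, (s / 2 + s ^ 3 / 2 * (psum (fun i _ => f i) n ω - n * m) ^ 2) ∂μ :=
        integral_mono i1 ((integrable_const _).add (i2.const_mul _)) hb
    _ = s / 2 + s ^ 3 / 2 * ∫ ω, (psum (fun i _ => f i) n ω - n * m) ^ 2 ∂μ := by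
        rw [integral_add (integrable_const _) (i2.const_mul _)]
        simp only [integral_const, integral_const_mul, probReal_univ, one_smul]
    _ ≤ s / 2 + s ^ 3 / 2 * (C * (n + 1)) := by
        have := hC n
        gcongr
    _ ≤ (1 / 2 + C) * s := by
        have : s ^ 3 * (n + 1) ≤ 2 * s := by
          have : s ^ 3 * n = s := by linear_combination s * hsn
          have : s ^ 3 ≤ s ^ 3 * n := le_mul_of_one_le_right (by positivity) hnpos
          linarith
        nlinarith

lemma exp_lip (a b c : ℝ) (ha : a ≤ c) (hb : b ≤ c) :
    |Real.exp a - Real.exp b| ≤ Real.exp c * |a - b| := by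
  wlog hab : b ≤ a generalizing a b
  · rw [abs_sub_comm, abs_sub_comm a b]
    exact this b a hb ha (by linarith)
  rw [abs_of_nonneg (sub_nonneg.2 (Real.exp_le_exp.2 hab)), abs_of_nonneg (sub_nonneg.2 hab)]
  have h1 := Real.add_one_le_exp (b - a)
  have h2 : Real.exp b = Real.exp a * Real.exp (b - a) := by rw [← Real.exp_add]; ring_nf
  have h3 : Real.exp a ≤ Real.exp c := Real.exp_le_exp.2 ha
  have h4 := Real.exp_pos a
  have h5 : Real.exp a * (a - b) ≤ Real.exp c * (a - b) :=
    mul_le_mul_of_nonneg_right h3 (by linarith)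
  have h6 : Real.exp a * (b - a + 1) ≤ Real.exp a * Real.exp (b - a) :=
    mul_le_mul_of_nonneg_left h1 h4.le
  linarith

theorem IsBarChain.clt [IsProbabilityMeasure μ] (h : IsBarChain N π0 k μ)
    (ξ : ℕ → ℕ → ℝ) (v : ℕ → ℝ)
    (hξ0 : ∀ i ≤ N, ∑ j ∈ range (N + 1), k i j * ξ i j = 0)
    (hξ2 : ∀ i ≤ N, ∑ j ∈ range (N + 1), k i j * ξ i j ^ 2 = v i) :
    Tendsto (fun n : ℕ => ∫ ω, Complex.exp (Complex.I *
      (((Real.sqrt n)⁻¹ * psum ξ n ω : ℝ) : ℂ)) ∂μ) atTop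
      (nhds (Complex.exp ((-(∑ j ∈ range (N + 1), π0 j * v j) / 2 : ℝ) : ℂ))) := by
  set s2 := ∑ j ∈ range (N + 1), π0 j * v j with hs2
  obtain ⟨B1, hB10, hB1⟩ := exists_bound2 N ξ
  obtain ⟨B2, hB20, hB2⟩ := exists_bound1 N v
  set B := max B1 B2 with hB
  have hB0 : 0 ≤ B := hB10.trans (le_max_left _ _)
  have hξB : ∀ i ≤ N, ∀ j ≤ N, |ξ i j| ≤ B := fun i hi j hj => (hB1 i hi j hj).trans (le_max_left _ _)
  have hvB : ∀ i ≤ N, v i ≤ B := fun i hi =>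
    (le_abs_self _).trans ((hB2 i hi).trans (le_max_right _ _))
  have hv0 : ∀ i ≤ N, 0 ≤ v i := fun i hi => by
    rw [← hξ2 i hi]
    refine Finset.sum_nonneg fun j hj => ?_
    exact mul_nonneg (h.k_pos i hi j (Nat.le_of_lt_succ (Finset.mem_range.1 hj))).le (sq_nonneg _)
  have hs2B : s2 ≤ B := by
    calc s2 ≤ ∑ j ∈ range (N + 1), π0 j * B := by
          refine Finset.sum_le_sum fun j hj => ?_
          have hj' := (Nat.le_of_lt_succ (Finset.mem_range.1 hj))
          exact mul_le_mul_of_nonneg_left (hvB j hj') (h.pi_nonneg j hj')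
      _ = B := by rw [← Finset.sum_mul, h.pi_sum, one_mul]
  set C := (2 * B) ^ 3 * Real.exp (2 * B) + B ^ 2 with hC
  have hC0 : 0 ≤ C := by positivity
  set V : ℕ → (ℕ → ℕ) → ℝ := fun m ω => psum (fun i _ => v i) m ω with hV
  have hVb : ∀ m : ℕ, ∀ ω : ℕ → ℕ, (∀ t, ω t ≤ N) → V m ω ≤ m * B := by
    intro m ω hω
    calc V m ω ≤ ∑ t ∈ range m, B := Finset.sum_le_sum fun t _ => hvB _ (hω t)
      _ = m * B := by simp
  let W : ℝ → ℕ → (ℕ → ℕ) → ℂ := fun s m ω =>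
    Complex.exp (Complex.I * ((s * psum ξ m ω : ℝ) : ℂ) + ((s ^ 2 / 2 * V m ω : ℝ) : ℂ))
  have hWd : ∀ s m, DepUpTo m (W s m) := by
    intro s m ω ω' hh
    simp only [W, hV, dep_psum ξ m ω ω' hh, dep_psum (fun i _ => v i) m ω ω' hh]
  have hWn : ∀ s m ω, ‖W s m ω‖ = Real.exp (s ^ 2 / 2 * V m ω) := by
    intro s m ω
    simp only [W]
    rw [Complex.norm_exp]
    congr 1
    rw [Complex.add_re, Complex.ofReal_re, Complex.re_mul_ofReal, Complex.I_re, zero_mul, zero_add]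
  -- main estimate
  have hmain : ∀ n : ℕ, 1 ≤ n → ∀ m ≤ n,
      ‖∫ ω, W (Real.sqrt n)⁻¹ m ω ∂μ - 1‖ ≤ m * (Real.exp (B / 2) * (C * (Real.sqrt n)⁻¹ ^ 3)) := by
    intro n hn m
    set s := (Real.sqrt n)⁻¹ with hs
    have hs0 : 0 ≤ s := by positivity
    have hs1 : s ≤ 1 := isqrt_le_one n hn
    have hsn : s ^ 2 * n = 1 := isqrt_sq n hn
    induction m with
    | zero => intro _; simp [W, hV, psum]
    | succ m ih =>
      intro hm
      have ih' := ih (by omega)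
      let g : ℕ → ℕ → ℂ := fun i j =>
        Complex.exp (Complex.I * ((s * ξ i j : ℝ) : ℂ) + ((s ^ 2 / 2 * v i : ℝ) : ℂ)) - 1
      have e1 : ∀ ω, W s (m + 1) ω = W s m ω + W s m ω * g (ω m) (ω (m + 1)) := by
        intro ω
        simp only [W, g, hV, psum, Finset.sum_range_succ]
        rw [mul_sub, mul_one, ← Complex.exp_add]
        rw [add_sub_cancel]
        congr 1
        push_cast
        ring
      have i1 := h.integrable (hWd s m)
      have i2 : Integrable (fun ω => W s m ω * g (ω m) (ω (m + 1))) μ :=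
        h.integrable (n := m + 1) (fun ω ω' hh => by
          simp only [hWd s m ω ω' (fun t ht => hh t (by omega)), hh m (by omega),
            hh (m + 1) le_rfl])
      have e2 : ∫ ω, W s (m + 1) ω ∂μ = ∫ ω, W s m ω ∂μ +
          ∫ ω, W s m ω * ∑ j ∈ range (N + 1), (k (ω m) j : ℂ) * g (ω m) j ∂μ := by
        rw [← h.markov (hWd s m) g, ← integral_add i1 i2]
        exact integral_congr_ae (Eventually.of_forall e1)
      have e3 : ‖∫ ω, W s m ω * ∑ j ∈ range (N + 1), (k (ω m) j : ℂ) * g (ω m) j ∂μ‖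
          ≤ Real.exp (B / 2) * (C * s ^ 3) := by
        have := norm_integral_le_of_norm_le_const (μ := μ)
          (f := fun ω => W s m ω * ∑ j ∈ range (N + 1), (k (ω m) j : ℂ) * g (ω m) j)
          (C := Real.exp (B / 2) * (C * s ^ 3)) ?_
        · simpa using this
        · filter_upwards [h.ae_le] with ω hω
          rw [norm_mul, hWn]
          refine mul_le_mul ?_ ?_ (norm_nonneg _) (Real.exp_pos _).le
          · rw [Real.exp_le_exp]
            have a1 := hVb m ω hω
            have a2 : (m : ℝ) ≤ n := by exact_mod_cast (by omega : m ≤ n)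
            have a3 : V m ω ≤ n * B := a1.trans (mul_le_mul_of_nonneg_right a2 hB0)
            calc s ^ 2 / 2 * V m ω ≤ s ^ 2 / 2 * (n * B) :=
                  mul_le_mul_of_nonneg_left a3 (by positivity)
              _ = B / 2 := by linear_combination B / 2 * hsn
          · have hi := hω m
            exact step_bound (N + 1) (k (ω m)) (ξ (ω m)) (v (ω m)) B s hs0 hs1
              (fun j hj => (h.k_pos _ hi j (Nat.le_of_lt_succ (Finset.mem_range.1 hj))).le)
              (h.k_sum _ hi)
              (fun j hj => hξB _ hi j (Nat.le_of_lt_succ (Finset.mem_range.1 hj)))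
              (hv0 _ hi) (hvB _ hi) (hξ0 _ hi) (hξ2 _ hi)
      rw [e2, add_sub_right_comm]
      refine (norm_add_le _ _).trans ?_
      push_cast
      linarith
  have hW1 : Tendsto (fun n : ℕ => ∫ ω, W (Real.sqrt n)⁻¹ n ω ∂μ) atTop (nhds 1) := by
    rw [tendsto_iff_norm_sub_tendsto_zero]
    have hlim : Tendsto (fun n : ℕ => (Real.exp (B / 2) * C) * (Real.sqrt n)⁻¹) atTop (nhds 0) := by
      simpa using tendsto_isqrt.const_mul (Real.exp (B / 2) * C)
    refine squeeze_zero' (Eventually.of_forall fun n => norm_nonneg _) ?_ hlim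
    filter_upwards [eventually_ge_atTop 1] with n hn
    refine (hmain n hn n le_rfl).trans (le_of_eq ?_)
    linear_combination Real.exp (B / 2) * C * (Real.sqrt n)⁻¹ * isqrt_sq n hn
  have hdiff : Tendsto (fun n : ℕ => Complex.exp ((s2 / 2 : ℝ) : ℂ) * ∫ ω, Complex.exp (Complex.I *
      (((Real.sqrt n)⁻¹ * psum ξ n ω : ℝ) : ℂ)) ∂μ - ∫ ω, W (Real.sqrt n)⁻¹ n ω ∂μ)
      atTop (nhds 0) := by
    have hl := (h.lln_L1 v).const_mul (Real.exp (B / 2) / 2)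
    rw [mul_zero] at hl
    refine squeeze_zero_norm' ?_ hl
    filter_upwards [eventually_ge_atTop 1] with n hn
    set s := (Real.sqrt n)⁻¹ with hs
    have hsn : s ^ 2 * n = 1 := isqrt_sq n hn
    have hnpos : (1 : ℝ) ≤ n := by exact_mod_cast hn
    have i1 : Integrable (fun ω => Complex.exp ((s2 / 2 : ℝ) : ℂ) * Complex.exp (Complex.I *
      ((s * psum ξ n ω : ℝ) : ℂ))) μ :=
      h.integrable (n := n) (fun ω ω' hh => by simp only [dep_psum ξ n ω ω' hh])
    have i3 : Integrable (fun ω => |V n ω / n - s2|) μ :=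
      h.integrable (n := n) (fun ω ω' hh => by
        simp only [hV, dep_psum (fun i _ => v i) n ω ω' hh])
    rw [← integral_const_mul, ← integral_sub i1 (h.integrable (hWd s n)), ← integral_const_mul]
    refine norm_integral_le_of_norm_le (i3.const_mul _) ?_
    filter_upwards [h.ae_le] with ω hω
    have e : Complex.exp ((s2 / 2 : ℝ) : ℂ) * Complex.exp (Complex.I * ((s * psum ξ n ω : ℝ) : ℂ))
        - W s n ω = Complex.exp (Complex.I * ((s * psum ξ n ω : ℝ) : ℂ)) *
          ((Real.exp (s2 / 2) - Real.exp (s ^ 2 / 2 * V n ω) : ℝ) : ℂ) := by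
      simp only [W]
      rw [Complex.exp_add]
      push_cast
      ring
    rw [e, norm_mul, mul_comm Complex.I, Complex.norm_exp_ofReal_mul_I, one_mul, Complex.norm_real,
      Real.norm_eq_abs]
    have e5 : s ^ 2 / 2 * V n ω = V n ω / n / 2 := by
      field_simp
      linear_combination (V n ω) * hsn
    rw [e5]
    refine (exp_lip _ _ (B / 2) (by linarith) ?_).trans (le_of_eq ?_)
    · have := hVb n ω hω
      have : V n ω / n ≤ B := by
        rw [div_le_iff₀ (by linarith)]; linarith
      linarith
    · rw [← sub_div, abs_div, abs_sub_comm]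
      norm_num
      ring
  have hfin := (hdiff.add hW1).const_mul (Complex.exp ((-s2 / 2 : ℝ) : ℂ))
  rw [zero_add, mul_one] at hfin
  refine hfin.congr fun n => ?_
  rw [sub_add_cancel, ← mul_assoc, ← Complex.exp_add]
  have : (((-s2 / 2 : ℝ) : ℂ) + ((s2 / 2 : ℝ) : ℂ)) = 0 := by push_cast; ring
  rw [this, Complex.exp_zero, one_mul]

end Chain

section ConvProb
variable {Ω E F : Type*} [MeasurableSpace Ω] {μ : Measure Ω} [IsProbabilityMeasure μ]
  [PseudoMetricSpace E] [PseudoMetricSpace F]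

/-- Convergence in probability to a constant. -/
def CP (μ : Measure Ω) (f : ℕ → Ω → E) (c : E) : Prop :=
  ∀ ε > 0, Tendsto (fun n => μ.real {ω | ε ≤ dist (f n ω) c}) atTop (nhds 0)

lemma CP.comp {f : ℕ → Ω → E} {c : E} (h : CP μ f c) {φ : E → F} (hφ : ContinuousAt φ c) :
    CP μ (fun n ω => φ (f n ω)) (φ c) := by
  intro ε hε
  obtain ⟨δ, hδ, hd⟩ := Metric.continuousAt_iff.1 hφ ε hε
  refine squeeze_zero (fun n => measureReal_nonneg) (fun n => measureReal_mono ?_) (h δ hδ)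
  intro ω hω
  by_contra hc
  simp only [Set.mem_ofPred_eq, not_le] at hω hc
  exact absurd (hd hc) (not_lt.2 hω)

lemma CP.prodMk {f : ℕ → Ω → E} {g : ℕ → Ω → F} {a : E} {b : F} (hf : CP μ f a) (hg : CP μ g b) :
    CP μ (fun n ω => (f n ω, g n ω)) (a, b) := by
  intro ε hε
  have := (hf ε hε).add (hg ε hε)
  rw [add_zero] at this
  refine squeeze_zero (fun n => measureReal_nonneg)
    (fun n => (measureReal_mono ?_).trans (measureReal_union_le _ _)) this
  intro ω hω
  simpa [Prod.dist_eq] using hω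

lemma CP.congr {f g : ℕ → Ω → E} {c : E} (hf : CP μ f c)
    (hfg : Tendsto (fun n => μ.real {ω | f n ω ≠ g n ω}) atTop (nhds 0)) : CP μ g c := by
  intro ε hε
  have := (hf ε hε).add hfg
  rw [add_zero] at this
  refine squeeze_zero (fun n => measureReal_nonneg)
    (fun n => (measureReal_mono ?_).trans (measureReal_union_le _ _)) this
  intro ω hω
  by_cases hh : f n ω = g n ω
  · left
    simp only [Set.mem_ofPred_eq] at hω ⊢
    rwa [hh]
  · right; exact hh

lemma CP.of_seq {s : ℕ → ℝ} {c : ℝ} (hs : Tendsto s atTop (nhds c)) :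
    CP μ (fun n _ => s n) c := by
  intro ε hε
  have : ∀ᶠ n in atTop, dist (s n) c < ε := Metric.tendsto_nhds.1 hs ε hε
  refine tendsto_const_nhds.congr' ?_
  filter_upwards [this] with n hn
  simp [not_le.2 hn]

lemma CP.add {f g : ℕ → Ω → ℝ} {a b : ℝ} (hf : CP μ f a) (hg : CP μ g b) :
    CP μ (fun n ω => f n ω + g n ω) (a + b) :=
  (hf.prodMk hg).comp (φ := fun x : ℝ × ℝ => x.1 + x.2) (by fun_prop)

lemma CP.of_L1 {f : ℕ → Ω → ℝ} {c : ℝ} (hi : ∀ n, Integrable (fun ω => |f n ω - c|) μ)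
    (h : Tendsto (fun n => ∫ ω, |f n ω - c| ∂μ) atTop (nhds 0)) : CP μ f c := by
  intro ε hε
  have h2 := h.const_mul ε⁻¹
  rw [mul_zero] at h2
  refine squeeze_zero (fun n => measureReal_nonneg) (fun n => ?_) h2
  have := mul_meas_ge_le_integral_of_nonneg (μ := μ)
    (Eventually.of_forall fun ω => abs_nonneg (f n ω - c)) (hi n) ε
  rw [inv_mul_eq_div, le_div_iff₀ hε, mul_comm]
  exact this

lemma CP.mul_bdd {Y H : ℕ → Ω → ℝ} (C : ℝ) (hi : ∀ n, Integrable (fun ω => (Y n ω) ^ 2) μ)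
    (hC : ∀ n, ∫ ω, (Y n ω) ^ 2 ∂μ ≤ C) (hH : CP μ H 0) : CP μ (fun n ω => Y n ω * H n ω) 0 := by
  intro ε hε
  have hC0 : 0 ≤ C := (integral_nonneg fun ω => sq_nonneg (Y 0 ω)).trans (hC 0)
  rw [Metric.tendsto_nhds]
  intro δ hδ
  obtain ⟨L, hL0, hL⟩ : ∃ L : ℝ, 0 < L ∧ C / L ^ 2 < δ / 2 := by
    refine ⟨Real.sqrt (2 * (C + 1) / δ), by positivity, ?_⟩
    rw [Real.sq_sqrt (by positivity)]
    rw [div_lt_iff₀ (by positivity)]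
    field_simp
    linarith
  have h1 := Metric.tendsto_nhds.1 (hH (ε / L) (by positivity)) (δ / 2) (by positivity)
  filter_upwards [h1] with n hn
  rw [Real.dist_eq, sub_zero, abs_of_nonneg measureReal_nonneg] at hn ⊢
  have h2 : μ.real {ω | L ^ 2 ≤ (Y n ω) ^ 2} ≤ C / L ^ 2 := by
    rw [le_div_iff₀ (by positivity), mul_comm]
    exact (mul_meas_ge_le_integral_of_nonneg (μ := μ)
      (Eventually.of_forall fun ω => sq_nonneg (Y n ω)) (hi n) (L ^ 2)).trans (hC n)
  have h3 : μ.real {ω | ε ≤ dist (Y n ω * H n ω) 0} ≤ μ.real {ω | L ^ 2 ≤ (Y n ω) ^ 2}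
      + μ.real {ω | ε / L ≤ dist (H n ω) 0} := by
    refine (measureReal_mono ?_).trans (measureReal_union_le _ _)
    intro ω hω
    by_contra hc
    simp only [Set.mem_union, Set.mem_ofPred_eq, not_or, not_le, Real.dist_eq, sub_zero,
      abs_mul] at hω hc
    have h4 : |Y n ω| < L := abs_lt_of_sq_lt_sq hc.1 hL0.le
    have h5 : |Y n ω| * |H n ω| < L * (ε / L) :=
      mul_lt_mul'' h4 hc.2 (abs_nonneg _) (abs_nonneg _)
    rw [mul_div_cancel₀ _ hL0.ne'] at h5
    linarith
  linarith

lemma CP.charfun {L Z : ℕ → Ω → ℝ} (hL : ∀ n, Measurable (L n)) (hZ : ∀ n, Measurable (Z n))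
    (h : CP μ (fun n ω => L n ω - Z n ω) 0) {z : ℂ}
    (hz : Tendsto (fun n => ∫ ω, Complex.exp (Complex.I * (Z n ω : ℂ)) ∂μ) atTop (nhds z)) :
    Tendsto (fun n => ∫ ω, Complex.exp (Complex.I * (L n ω : ℂ)) ∂μ) atTop (nhds z) := by
  have hi : ∀ f : Ω → ℝ, Measurable f → Integrable (fun ω => Complex.exp (Complex.I * (f ω : ℂ))) μ := by
    intro f hf
    refine Integrable.of_bound (C := 1) (by fun_prop) (Eventually.of_forall fun ω => ?_)
    rw [mul_comm, Complex.norm_exp_ofReal_mul_I]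
  suffices hd : Tendsto (fun n => ∫ ω, Complex.exp (Complex.I * (L n ω : ℂ)) ∂μ
      - ∫ ω, Complex.exp (Complex.I * (Z n ω : ℂ)) ∂μ) atTop (nhds 0) by
    have := hd.add hz
    simpa using this
  rw [Metric.tendsto_nhds]
  intro δ hδ
  have h1 := Metric.tendsto_nhds.1 (h (δ / 4) (by positivity)) (δ / 4) (by positivity)
  filter_upwards [h1] with n hn
  rw [Real.dist_eq, sub_zero, abs_of_nonneg measureReal_nonneg] at hn
  rw [dist_zero_right, ← integral_sub (hi _ (hL n)) (hi _ (hZ n))]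
  set A : Set Ω := {ω | δ / 4 ≤ dist (L n ω - Z n ω) 0} with hA
  have hAm : MeasurableSet A := by
    have := hL n
    have := hZ n
    exact measurableSet_le measurable_const (by fun_prop)
  have hb : ‖∫ ω, (Complex.exp (Complex.I * (L n ω : ℂ)) - Complex.exp (Complex.I * (Z n ω : ℂ))) ∂μ‖
      ≤ ∫ ω, (δ / 4 + A.indicator (fun _ => (2 : ℝ)) ω) ∂μ := by
    refine norm_integral_le_of_norm_le ((integrable_const _).add
      ((integrable_const _).indicator hAm)) (Eventually.of_forall fun ω => ?_)
    by_cases hω : ω ∈ A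
    · rw [Set.indicator_of_mem hω]
      refine (norm_sub_le _ _).trans ?_
      rw [mul_comm, Complex.norm_exp_ofReal_mul_I, mul_comm, Complex.norm_exp_ofReal_mul_I]
      linarith
    · rw [Set.indicator_of_notMem hω, add_zero]
      simp only [hA, Set.mem_ofPred_eq, not_le, Real.dist_eq, sub_zero] at hω
      have e : Complex.exp (Complex.I * (L n ω : ℂ)) - Complex.exp (Complex.I * (Z n ω : ℂ))
        = Complex.exp (Complex.I * (Z n ω : ℂ)) *
          (Complex.exp (Complex.I * ((L n ω - Z n ω : ℝ) : ℂ)) - 1) := by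
        rw [mul_sub, mul_one, ← Complex.exp_add]
        congr 2
        push_cast; ring
      rw [e, norm_mul, mul_comm Complex.I, Complex.norm_exp_ofReal_mul_I, one_mul]
      refine (Real.norm_exp_I_mul_ofReal_sub_one_le).trans ?_
      rw [Real.norm_eq_abs]; exact hω.le
  refine lt_of_le_of_lt hb ?_
  rw [integral_add (integrable_const _) ((integrable_const _).indicator hAm),
    integral_indicator_const _ hAm]
  simp only [integral_const, probReal_univ, one_smul, smul_eq_mul]
  linarith

end ConvProb

lemma sum_Icc_shift (f : ℕ → ℝ) (n : ℕ) : ∑ t ∈ Finset.Icc 1 n, f t = ∑ t ∈ range n, f (t + 1) := by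
  induction n with
  | zero => simp
  | succ n ih => rw [Finset.sum_Icc_succ_top (by omega), ih, Finset.sum_range_succ]

lemma measurable_psum (d : ℕ → ℕ → ℝ) (n : ℕ) : Measurable (psum d n) := by
  unfold psum
  refine Finset.measurable_sum _ fun t _ => ?_
  have h1 : Measurable (fun q : ℕ × ℕ => d q.1 q.2) := measurable_of_countable _
  have h2 : Measurable (fun ω : ℕ → ℕ => (ω t, ω (t + 1))) :=
    (measurable_pi_apply t).prodMk (measurable_pi_apply (t + 1))
  exact h1.comp h2

/-- The innovation. -/
def innov (N : ℕ) (ρ p : ℝ) (i j : ℕ) : ℝ := j - ρ * i - N * (p * (1 - ρ))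

lemma clsRho_eq (ω : ℕ → ℕ) (n : ℕ) : clsRho (xR ω) n =
    (n * psum (fun i j => (j : ℝ) * i) n ω - psum (fun _ j => (j : ℝ)) n ω * psum (fun i _ => (i : ℝ)) n ω)
    / (n * psum (fun i _ => (i : ℝ) ^ 2) n ω - (psum (fun i _ => (i : ℝ)) n ω) ^ 2) := by
  simp only [clsRho, sum_Icc_shift, xR, psum, Nat.add_sub_cancel]

lemma clsP_eq (N : ℕ) (ω : ℕ → ℕ) (n : ℕ) : clsP N (xR ω) n =
    (psum (fun _ j => (j : ℝ)) n ω - clsRho (xR ω) n * psum (fun i _ => (i : ℝ)) n ω)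
    / (n * N * (1 - clsRho (xR ω) n)) := by
  simp only [clsP, sum_Icc_shift, xR, psum, Nat.add_sub_cancel]

lemma measurable_clsRho (n : ℕ) : Measurable (fun ω => clsRho (xR ω) n) := by
  simp only [clsRho_eq]
  have h1 := measurable_psum (fun i j => (j : ℝ) * i) n
  have h2 := measurable_psum (fun _ j => (j : ℝ)) n
  have h3 := measurable_psum (fun i _ => (i : ℝ)) n
  have h4 := measurable_psum (fun i _ => (i : ℝ) ^ 2) n
  fun_prop

lemma measurable_clsP (N n : ℕ) : Measurable (fun ω => clsP N (xR ω) n) := by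
  simp only [clsP_eq]
  have h2 := measurable_psum (fun _ j => (j : ℝ)) n
  have h3 := measurable_psum (fun i _ => (i : ℝ)) n
  have h4 := measurable_clsRho n
  fun_prop

lemma psum_innov (N : ℕ) (ρ p : ℝ) (n : ℕ) (ω : ℕ → ℕ) :
    psum (innov N ρ p) n ω = psum (fun _ j => (j : ℝ)) n ω - ρ * psum (fun i _ => (i : ℝ)) n ω
      - n * (N * (p * (1 - ρ))) := by
  simp only [psum, innov, Finset.sum_sub_distrib, Finset.mul_sum]
  simp

lemma psum_innov' (N : ℕ) (ρ p : ℝ) (n : ℕ) (ω : ℕ → ℕ) :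
    psum (fun i j => ((i : ℝ) - N * p) * innov N ρ p i j) n ω =
      psum (fun i j => (j : ℝ) * i) n ω - ρ * psum (fun i _ => (i : ℝ) ^ 2) n ω
      - N * (p * (1 - ρ)) * psum (fun i _ => (i : ℝ)) n ω - N * p * psum (innov N ρ p) n ω := by
  simp only [psum, innov, Finset.mul_sum, ← Finset.sum_sub_distrib]
  refine Finset.sum_congr rfl fun t _ => ?_
  ring

section
variable (N : ℕ) (ρ p : ℝ)

def uN (n : ℕ) (ω : ℕ → ℕ) : ℝ :=
  (Real.sqrt n)⁻¹ * psum (fun i j => ((i : ℝ) - N * p) * innov N ρ p i j) n ω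
def tN (n : ℕ) (ω : ℕ → ℕ) : ℝ := (Real.sqrt n)⁻¹ * psum (innov N ρ p) n ω
def m1N (n : ℕ) (ω : ℕ → ℕ) : ℝ := psum (fun i _ => (i : ℝ)) n ω / n
def m2N (n : ℕ) (ω : ℕ → ℕ) : ℝ := psum (fun i _ => (i : ℝ) ^ 2) n ω / n
def mN (n : ℕ) (ω : ℕ → ℕ) : ℝ := m1N n ω - N * p
def dN (n : ℕ) (ω : ℕ → ℕ) : ℝ := m2N n ω - (m1N n ω) ^ 2

lemma rho_good (n : ℕ) (hn : 1 ≤ n) (ω : ℕ → ℕ) (hD : dN n ω ≠ 0) :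
    clsRho (xR ω) n - ρ = (Real.sqrt n)⁻¹ * ((uN N ρ p n ω - mN N p n ω * tN N ρ p n ω) / dN n ω) := by
  have hn0 : (n : ℝ) ≠ 0 := by positivity
  have hs := isqrt_sq n hn
  set s := (Real.sqrt n)⁻¹
  have hden : n * psum (fun i _ => (i : ℝ) ^ 2) n ω - (psum (fun i _ => (i : ℝ)) n ω) ^ 2
      = n ^ 2 * dN n ω := by
    unfold dN m2N m1N
    field_simp
  have hden0 : (n : ℝ) ^ 2 * dN n ω ≠ 0 := mul_ne_zero (pow_ne_zero _ hn0) hD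
  have hnum : n * psum (fun i j => (j : ℝ) * i) n ω
      - psum (fun _ j => (j : ℝ)) n ω * psum (fun i _ => (i : ℝ)) n ω
      = ρ * (n ^ 2 * dN n ω) + n ^ 2 * (s * (uN N ρ p n ω - mN N p n ω * tN N ρ p n ω)) := by
    have e : n ^ 2 * (s * (uN N ρ p n ω - mN N p n ω * tN N ρ p n ω)) =
      (s ^ 2 * n) * (n * psum (fun i j => ((i : ℝ) - N * p) * innov N ρ p i j) n ω
        - (n * mN N p n ω) * psum (innov N ρ p) n ω) := by
      unfold uN tN; ring
    have e2 : n * mN N p n ω = psum (fun i _ => (i : ℝ)) n ω - n * (N * p) := by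
      unfold mN m1N; field_simp
    rw [e, hs, e2, psum_innov', psum_innov, ← hden]
    ring
  rw [clsRho_eq, hden, hnum]
  field_simp
  ring

lemma p_good (n : ℕ) (hn : 1 ≤ n) (hN : 1 ≤ N) (ω : ℕ → ℕ) (hr : clsRho (xR ω) n ≠ 1) :
    clsP N (xR ω) n - p = ((Real.sqrt n)⁻¹ * tN N ρ p n ω - (clsRho (xR ω) n - ρ) * mN N p n ω)
      / (N * (1 - clsRho (xR ω) n)) := by
  have hn0 : (n : ℝ) ≠ 0 := by positivity
  have hN0 : (N : ℝ) ≠ 0 := by positivity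
  have hr0 : 1 - clsRho (xR ω) n ≠ 0 := sub_ne_zero.2 (Ne.symm hr)
  have hs := isqrt_sq n hn
  have e : (Real.sqrt n)⁻¹ * tN N ρ p n ω = psum (innov N ρ p) n ω / n := by
    unfold tN
    rw [eq_div_iff hn0]
    linear_combination (psum (innov N ρ p) n ω) * hs
  rw [e, psum_innov, clsP_eq]
  unfold mN m1N
  field_simp
  ring

/-- The coefficient functions of the remainder, as functions of `(m, (d, r))`. -/
def rem1 (u1 u2 d : ℝ) (y : ℝ × (ℝ × ℝ)) : ℝ :=
  u1 * (y.2.1⁻¹ - d⁻¹) - u2 * y.1 * y.2.1⁻¹ * (N * (1 - y.2.2))⁻¹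
def rem2 (u1 u2 : ℝ) (y : ℝ × (ℝ × ℝ)) : ℝ :=
  - u1 * y.1 * y.2.1⁻¹ + u2 * ((N * (1 - y.2.2))⁻¹ - (N * (1 - ρ))⁻¹)
    + u2 * y.1 ^ 2 * y.2.1⁻¹ * (N * (1 - y.2.2))⁻¹

lemma rem_good (n : ℕ) (hn : 1 ≤ n) (hN : 1 ≤ N) (hρ : ρ < 1) (d : ℝ) (hd : d ≠ 0)
    (ω : ℕ → ℕ) (hD : dN n ω ≠ 0) (hr : clsRho (xR ω) n ≠ 1) (u1 u2 : ℝ) :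
    uN N ρ p n ω * rem1 N u1 u2 d (mN N p n ω, dN n ω, clsRho (xR ω) n)
      + tN N ρ p n ω * rem2 N ρ u1 u2 (mN N p n ω, dN n ω, clsRho (xR ω) n)
    = (u1 * (Real.sqrt n * (clsRho (xR ω) n - ρ)) + u2 * (Real.sqrt n * (clsP N (xR ω) n - p)))
      - (u1 / d * uN N ρ p n ω + u2 / (N * (1 - ρ)) * tN N ρ p n ω) := by
  have hN0 : (N : ℝ) ≠ 0 := by positivity
  have hr0 : 1 - clsRho (xR ω) n ≠ 0 := sub_ne_zero.2 (Ne.symm hr)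
  have hρ0 : 1 - ρ ≠ 0 := by linarith
  have hs : Real.sqrt n ≠ 0 := by positivity
  rw [p_good N ρ p n hn hN ω hr]
  have h1 := rho_good N ρ p n hn ω hD
  rw [h1]
  simp only [rem1, rem2]
  generalize clsRho (xR ω) n = r at *
  field_simp
  ring
end

lemma isBarChain_of_cyl (N : ℕ) (p ρ : ℝ) (hp0 : 0 < p) (hp1 : p < 1)
    (hρl : max (-(p / (1 - p))) (-((1 - p) / p)) < ρ) (hρu : ρ < 1)
    (μ : Measure (ℕ → ℕ))
    (hμ : ∀ (n : ℕ) (x : ℕ → ℕ),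
      μ {ω | ∀ t ≤ n, ω t = x t} =
        ENNReal.ofReal (binomPMF N p (x 0) *
          ∏ t ∈ Finset.Icc 1 n, barK N ρ p (x (t - 1)) (x t))) :
    IsBarChain N (binomPMF N p) (barK N ρ p) μ := by
  have hq : 0 < 1 - p := by linarith
  have hr : 0 < 1 - ρ := by linarith
  obtain ⟨h1, h2⟩ := max_lt_iff.1 hρl
  have hb0 : 0 < p * (1 - ρ) := mul_pos hp0 hr
  have hb1 : p * (1 - ρ) < 1 := by
    have : -ρ * p < 1 - p := by
      rw [← lt_div_iff₀ hp0]; linarith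
    nlinarith
  have ha0 : 0 < p * (1 - ρ) + ρ := by
    have : -ρ * (1 - p) < p := by
      rw [← lt_div_iff₀ hq]; linarith
    nlinarith
  have ha1 : p * (1 - ρ) + ρ < 1 := by nlinarith [mul_pos hq hr]
  exact
  { pi_nonneg := fun i _ => by unfold binomPMF; positivity
    pi_zero := fun i hi => by simp [binomPMF, Nat.choose_eq_zero_of_lt hi]
    k_pos := fun i hi j hj => barK_pos N ρ p i j hj hi hb0 hb1 ha0 ha1
    k_zero := fun i hi j hj => barK_zero N ρ p i j hj hi
    k_sum := fun i hi => barK_sum N ρ p i hi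
    pi_sum := binom_sum N p
    pi_inv := fun j _ => binom_inv N ρ p j
    cyl := hμ }

lemma innov_mean (N : ℕ) (ρ p : ℝ) (c : ℕ → ℝ) (i : ℕ) (hi : i ≤ N) :
    ∑ j ∈ range (N + 1), barK N ρ p i j * (c i * innov N ρ p i j) = 0 := by
  have h0 := barK_sum N ρ p i hi
  have h1 := barK_mean N ρ p i hi
  have e : ∀ j, barK N ρ p i j * (c i * innov N ρ p i j) = c i * (barK N ρ p i j * j)
      - c i * (ρ * i + N * (p * (1 - ρ))) * barK N ρ p i j := by
    intro j; unfold innov; ring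
  simp only [e, Finset.sum_sub_distrib, ← Finset.mul_sum, h0, h1]
  ring

lemma innov_var (N : ℕ) (ρ p : ℝ) (c : ℕ → ℝ) (i : ℕ) (hi : i ≤ N) :
    ∑ j ∈ range (N + 1), barK N ρ p i j * (c i * innov N ρ p i j) ^ 2
      = c i ^ 2 * sigmaSq N ρ p i := by
  rw [← barK_var N ρ p i hi, Finset.mul_sum]
  refine Finset.sum_congr rfl fun j _ => ?_
  unfold innov; ring

section
variable {N : ℕ} {ρ p : ℝ} {μ : Measure (ℕ → ℕ)} [IsProbabilityMeasure μ]

lemma norm_psum_sq (h : IsBarChain N (binomPMF N p) (barK N ρ p) μ) (c : ℕ → ℝ) :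
    (∀ n : ℕ, Integrable (fun ω =>
      ((Real.sqrt n)⁻¹ * psum (fun i j => c i * innov N ρ p i j) n ω) ^ 2) μ) ∧
    ∃ C : ℝ, ∀ n : ℕ, ∫ ω, ((Real.sqrt n)⁻¹ *
      psum (fun i j => c i * innov N ρ p i j) n ω) ^ 2 ∂μ ≤ C := by
  refine ⟨fun n => h.integrable (n := n) (fun ω ω' hh => by
    simp only [dep_psum (fun i j => c i * innov N ρ p i j) n ω ω' hh]), ?_⟩
  obtain ⟨B, hB0, hB⟩ := exists_bound2 N (fun i j => c i * innov N ρ p i j)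
  refine ⟨B ^ 2, fun n => ?_⟩
  have h1 := h.mart_sq _ (fun i hi => innov_mean N ρ p c i hi) B hB n
  simp only [mul_pow, integral_const_mul]
  rcases Nat.eq_zero_or_pos n with rfl | hn
  · simp; positivity
  · have h2 := isqrt_sq n hn
    calc _ ≤ ((Real.sqrt n)⁻¹) ^ 2 * (n * B ^ 2) := by gcongr
      _ = B ^ 2 := by rw [← mul_assoc, h2, one_mul]

lemma uN_bdd (h : IsBarChain N (binomPMF N p) (barK N ρ p) μ) :
    (∀ n : ℕ, Integrable (fun ω => (uN N ρ p n ω) ^ 2) μ) ∧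
    ∃ C : ℝ, ∀ n : ℕ, ∫ ω, (uN N ρ p n ω) ^ 2 ∂μ ≤ C :=
  norm_psum_sq h (fun i => (i : ℝ) - N * p)

lemma tN_bdd (h : IsBarChain N (binomPMF N p) (barK N ρ p) μ) :
    (∀ n : ℕ, Integrable (fun ω => (tN N ρ p n ω) ^ 2) μ) ∧
    ∃ C : ℝ, ∀ n : ℕ, ∫ ω, (tN N ρ p n ω) ^ 2 ∂μ ≤ C := by
  have := norm_psum_sq h (fun _ => 1)
  simp only [one_mul] at this
  exact this

lemma cp_lln (h : IsBarChain N (binomPMF N p) (barK N ρ p) μ) (f : ℕ → ℝ) :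
    CP μ (fun n ω => psum (fun i _ => f i) n ω / n)
      (∑ j ∈ range (N + 1), binomPMF N p j * f j) := by
  refine CP.of_L1 (fun n => h.integrable (n := n) (fun ω ω' hh => by
    simp only [dep_psum (fun i _ => f i) n ω ω' hh])) (h.lln_L1 f)

lemma cp_m1 (h : IsBarChain N (binomPMF N p) (barK N ρ p) μ) : CP μ m1N (N * p) := by
  have := cp_lln h (fun i => (i : ℝ))
  rw [binom_mean] at this
  exact this

lemma cp_m2 (h : IsBarChain N (binomPMF N p) (barK N ρ p) μ) :
    CP μ m2N (N * p * (1 - p) + (N * p) ^ 2) := by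
  have := cp_lln h (fun i => (i : ℝ) ^ 2)
  rw [binom_sq] at this
  exact this

lemma cp_mN (h : IsBarChain N (binomPMF N p) (barK N ρ p) μ) : CP μ (mN N p) 0 := by
  have := (cp_m1 h).comp (φ := fun x : ℝ => x - N * p) (by fun_prop)
  simp only [sub_self] at this
  exact this

lemma cp_dN (h : IsBarChain N (binomPMF N p) (barK N ρ p) μ) : CP μ dN (N * p * (1 - p)) := by
  have := ((cp_m2 h).prodMk (cp_m1 h)).comp (φ := fun x : ℝ × ℝ => x.1 - x.2 ^ 2) (by fun_prop)
  simp only [add_sub_cancel_right] at this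
  exact this

lemma bad_le {f : ℕ → (ℕ → ℕ) → ℝ} {c b : ℝ} (hf : CP μ f c) (hcb : c ≠ b) :
    Tendsto (fun n => μ.real {ω | f n ω = b}) atTop (nhds 0) := by
  have h0 : 0 < dist b c := dist_pos.2 (Ne.symm hcb)
  refine squeeze_zero (fun n => measureReal_nonneg) (fun n => measureReal_mono ?_) (hf _ h0)
  intro ω hω
  simp only [Set.mem_ofPred_eq] at hω ⊢
  rw [hω]

lemma cp_rho (h : IsBarChain N (binomPMF N p) (barK N ρ p) μ) (hd : (N : ℝ) * p * (1 - p) ≠ 0) :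
    CP μ (fun n ω => clsRho (xR ω) n) ρ := by
  obtain ⟨iu, Cu, hu⟩ := uN_bdd h
  obtain ⟨it, Ct, ht⟩ := tN_bdd h
  have hs : CP μ (fun n _ => (Real.sqrt n)⁻¹) 0 := CP.of_seq tendsto_isqrt
  have hall := hs.prodMk ((cp_mN h).prodMk (cp_dN h))
  have h1 := hall.comp (φ := fun x : ℝ × ℝ × ℝ => x.1 / x.2.2) (by
    refine ContinuousAt.div (by fun_prop) (by fun_prop) hd)
  have h2 := hall.comp (φ := fun x : ℝ × ℝ × ℝ => - (x.1 * x.2.1 / x.2.2)) (by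
    refine ContinuousAt.neg (ContinuousAt.div (by fun_prop) (by fun_prop) hd))
  simp only [zero_div, zero_mul, neg_zero] at h1 h2
  have h3 := ((CP.mul_bdd Cu iu hu h1).add (CP.mul_bdd Ct it ht h2)).add
    (CP.of_seq (μ := μ) (tendsto_const_nhds (x := ρ)))
  simp only [zero_add] at h3
  refine h3.congr ?_
  refine squeeze_zero' (Eventually.of_forall fun n => measureReal_nonneg) ?_ (bad_le (cp_dN h) hd)
  filter_upwards [eventually_ge_atTop 1] with n hn
  refine measureReal_mono ?_
  intro ω hω
  simp only [Set.mem_ofPred_eq] at hω ⊢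
  by_contra hc
  apply hω
  have := rho_good N ρ p n hn ω hc
  linear_combination -this

lemma cp_diff (h : IsBarChain N (binomPMF N p) (barK N ρ p) μ) (hd : (N : ℝ) * p * (1 - p) ≠ 0)
    (hN : 1 ≤ N) (hρ : ρ < 1) (u1 u2 : ℝ) :
    CP μ (fun n ω =>
      (u1 * (Real.sqrt n * (clsRho (xR ω) n - ρ)) + u2 * (Real.sqrt n * (clsP N (xR ω) n - p)))
      - (u1 / (N * p * (1 - p)) * uN N ρ p n ω + u2 / (N * (1 - ρ)) * tN N ρ p n ω)) 0 := by
  obtain ⟨iu, Cu, hu⟩ := uN_bdd h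
  obtain ⟨it, Ct, ht⟩ := tN_bdd h
  have hN0 : (N : ℝ) ≠ 0 := by positivity
  have hNr : (N : ℝ) * (1 - ρ) ≠ 0 := mul_ne_zero hN0 (by linarith)
  have hall := (cp_mN h).prodMk ((cp_dN h).prodMk (cp_rho h hd))
  have h1 := hall.comp (φ := rem1 N u1 u2 (N * p * (1 - p))) (by
    unfold rem1
    have c1 : ContinuousAt (fun y : ℝ × ℝ × ℝ => y.2.1⁻¹) (0, N * p * (1 - p), ρ) :=
      ContinuousAt.inv₀ (by fun_prop) hd
    have c2 : ContinuousAt (fun y : ℝ × ℝ × ℝ => ((N : ℝ) * (1 - y.2.2))⁻¹) (0, N * p * (1 - p), ρ) :=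
      ContinuousAt.inv₀ (by fun_prop) hNr
    fun_prop)
  have h2 := hall.comp (φ := rem2 N ρ u1 u2) (by
    unfold rem2
    have c1 : ContinuousAt (fun y : ℝ × ℝ × ℝ => y.2.1⁻¹) (0, N * p * (1 - p), ρ) :=
      ContinuousAt.inv₀ (by fun_prop) hd
    have c2 : ContinuousAt (fun y : ℝ × ℝ × ℝ => ((N : ℝ) * (1 - y.2.2))⁻¹) (0, N * p * (1 - p), ρ) :=
      ContinuousAt.inv₀ (by fun_prop) hNr
    fun_prop)
  have z1 : rem1 N u1 u2 (N * p * (1 - p)) (0, N * p * (1 - p), ρ) = 0 := by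
    simp [rem1]
  have z2 : rem2 N ρ u1 u2 (0, N * p * (1 - p), ρ) = 0 := by
    simp [rem2]
  rw [z1] at h1
  rw [z2] at h2
  have h3 := (CP.mul_bdd Cu iu hu h1).add (CP.mul_bdd Ct it ht h2)
  simp only [zero_add] at h3
  refine h3.congr ?_
  have hb := (bad_le (cp_dN h) hd).add (bad_le (cp_rho h hd) hρ.ne)
  rw [add_zero] at hb
  refine squeeze_zero' (Eventually.of_forall fun n => measureReal_nonneg) ?_ hb
  filter_upwards [eventually_ge_atTop 1] with n hn
  refine (measureReal_mono ?_).trans (measureReal_union_le _ _)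
  intro ω hω
  simp only [Set.mem_ofPred_eq, Set.mem_union] at hω ⊢
  by_contra hc
  push Not at hc
  exact hω (rem_good N ρ p n hn hN hρ _ hd ω hc.1 hc.2 u1 u2)

lemma cov_eq (hN : 1 ≤ N) (hp0 : 0 < p) (hp1 : p < 1) (hρ : ρ < 1) (u1 u2 : ℝ) :
    ![u1, u2] ⬝ᵥ ((Vmat N ρ p)⁻¹ * Wcls N ρ p * (Vmat N ρ p)⁻¹).mulVec ![u1, u2] =
    ∑ j ∈ range (N + 1), binomPMF N p j *
      ((u1 / (N * p * (1 - p)) * ((j : ℝ) - N * p) + u2 / (N * (1 - ρ))) ^ 2 * sigmaSq N ρ p j) := by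
  have hN0 : (N : ℝ) ≠ 0 := by positivity
  have hp : p ≠ 0 := hp0.ne'
  have hq : 1 - p ≠ 0 := by linarith
  have hr : 1 - ρ ≠ 0 := by linarith
  have hV : (Vmat N ρ p)⁻¹ = Matrix.diagonal
      ![((N : ℝ) * p * (1 - p))⁻¹, ((N : ℝ) ^ 2 * (1 - ρ) ^ 2)⁻¹] := by
    apply Matrix.inv_eq_right_inv
    unfold Vmat
    rw [Matrix.diagonal_mul_diagonal, ← Matrix.diagonal_one]
    congr 1
    funext i
    fin_cases i
    · simp; field_simp
    · simp; field_simp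
  have hR : ∑ j ∈ range (N + 1), binomPMF N p j *
      ((u1 / (N * p * (1 - p)) * ((j : ℝ) - N * p) + u2 / (N * (1 - ρ))) ^ 2 * sigmaSq N ρ p j)
      = (u1 / (N * p * (1 - p))) ^ 2 *
        ∑ i ∈ Finset.range (N + 1), binomPMF N p i * ((i : ℝ) - N * p) ^ 2 * sigmaSq N ρ p i
      + 2 * (u1 / (N * p * (1 - p))) * (u2 / (N * (1 - ρ))) *
        ∑ i ∈ Finset.range (N + 1), binomPMF N p i * ((i : ℝ) - N * p) * sigmaSq N ρ p i
      + (u2 / (N * (1 - ρ))) ^ 2 * ∑ i ∈ Finset.range (N + 1), binomPMF N p i * sigmaSq N ρ p i := by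
    simp only [Finset.mul_sum, ← Finset.sum_add_distrib]
    refine Finset.sum_congr rfl fun j _ => ?_
    ring
  rw [hR, hV]
  unfold Wcls
  generalize ∑ i ∈ Finset.range (N + 1), binomPMF N p i * ((i : ℝ) - N * p) ^ 2 * sigmaSq N ρ p i = S2
  generalize ∑ i ∈ Finset.range (N + 1), binomPMF N p i * ((i : ℝ) - N * p) * sigmaSq N ρ p i = S1
  generalize ∑ i ∈ Finset.range (N + 1), binomPMF N p i * sigmaSq N ρ p i = S0
  simp [Matrix.mulVec, dotProduct, Fin.sum_univ_two, Matrix.mul_diagonal, Matrix.diagonal_mul]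
  field_simp
  ring

lemma char_lim (h : IsBarChain N (binomPMF N p) (barK N ρ p) μ)
    (hN : 1 ≤ N) (hp0 : 0 < p) (hp1 : p < 1) (hρ : ρ < 1) (u1 u2 : ℝ) :
    Tendsto (fun n : ℕ => ∫ ω, Complex.exp (Complex.I *
      ((u1 * (Real.sqrt n * (clsRho (xR ω) n - ρ))
        + u2 * (Real.sqrt n * (clsP N (xR ω) n - p)) : ℝ) : ℂ)) ∂μ) atTop
      (nhds (Complex.exp (((-(![u1, u2] ⬝ᵥ
              ((Vmat N ρ p)⁻¹ * Wcls N ρ p * (Vmat N ρ p)⁻¹).mulVec ![u1, u2]) / 2 : ℝ) : ℂ)))) := by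
  have hd : (N : ℝ) * p * (1 - p) ≠ 0 := by
    have : (0 : ℝ) < 1 - p := by linarith
    positivity
  rw [cov_eq hN hp0 hp1 hρ]
  have hcl := h.clt
    (fun i j => (u1 / (N * p * (1 - p)) * ((i : ℝ) - N * p) + u2 / (N * (1 - ρ))) * innov N ρ p i j)
    (fun i => (u1 / (N * p * (1 - p)) * ((i : ℝ) - N * p) + u2 / (N * (1 - ρ))) ^ 2 * sigmaSq N ρ p i)
    (fun i hi => innov_mean N ρ p
      (fun i => u1 / (N * p * (1 - p)) * ((i : ℝ) - N * p) + u2 / (N * (1 - ρ))) i hi)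
    (fun i hi => innov_var N ρ p
      (fun i => u1 / (N * p * (1 - p)) * ((i : ℝ) - N * p) + u2 / (N * (1 - ρ))) i hi)
  have mu : ∀ n, Measurable (uN N ρ p n) := fun n => by
    unfold uN
    exact (measurable_psum _ n).const_mul _
  have mt : ∀ n, Measurable (tN N ρ p n) := fun n => by
    unfold tN
    exact (measurable_psum _ n).const_mul _
  have mr := measurable_clsRho
  have mp := measurable_clsP N
  refine CP.charfun (fun n => ?_) (fun n => ?_) (cp_diff h hd hN hρ u1 u2) ?_
  · have := mr n
    have := mp n
    fun_prop
  · have := mu n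
    have := mt n
    fun_prop
  · refine hcl.congr fun n => ?_
    congr 1
    funext ω
    congr 3
    simp only [uN, tN, psum, Finset.mul_sum, ← Finset.sum_add_distrib]
    refine Finset.sum_congr rfl fun t _ => ?_
    ring
end

lemma weak_of_char (μ : Measure (ℕ → ℕ)) [IsProbabilityMeasure μ]
    (G : Measure (ℝ × ℝ)) [IsProbabilityMeasure G]
    (Y : ℕ → (ℕ → ℕ) → ℝ × ℝ) (hY : ∀ n, Measurable (Y n))
    (hc : ∀ u1 u2 : ℝ, Tendsto (fun n : ℕ => ∫ ω, Complex.exp (Complex.I *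
      ((u1 * (Y n ω).1 + u2 * (Y n ω).2 : ℝ) : ℂ)) ∂μ) atTop
      (nhds (∫ x, Complex.exp (Complex.I * ((u1 * x.1 + u2 * x.2 : ℝ) : ℂ)) ∂G)))
    (f : BoundedContinuousFunction (ℝ × ℝ) ℝ) :
    Tendsto (fun n : ℕ => ∫ ω, f (Y n ω) ∂μ) atTop (nhds (∫ x, f x ∂G)) := by
  let T : ℝ × ℝ → WithLp 2 (ℝ × ℝ) := WithLp.toLp 2
  have hTc : Continuous T := WithLp.prod_continuous_toLp 2 ℝ ℝ
  have hT : Measurable T := hTc.measurable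
  have hRc : Continuous (fun x : WithLp 2 (ℝ × ℝ) => x.ofLp) := WithLp.prod_continuous_ofLp 2 ℝ ℝ
  have hTY : ∀ n, Measurable (fun ω => T (Y n ω)) := fun n => hT.comp (hY n)
  let P : ℕ → ProbabilityMeasure (WithLp 2 (ℝ × ℝ)) := fun n =>
    ⟨μ.map (fun ω => T (Y n ω)), Measure.isProbabilityMeasure_map (hTY n).aemeasurable⟩
  let Q : ProbabilityMeasure (WithLp 2 (ℝ × ℝ)) :=
    ⟨G.map T, Measure.isProbabilityMeasure_map hT.aemeasurable⟩
  have hPQ : Tendsto P atTop (nhds Q) := by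
    rw [ProbabilityMeasure.tendsto_iff_tendsto_charFun]
    intro t
    have hm : ∀ ν : Measure (WithLp 2 (ℝ × ℝ)), AEStronglyMeasurable
        (fun x => Complex.exp ((inner ℝ x t : ℝ) * Complex.I)) ν := fun ν => by
      refine Continuous.aestronglyMeasurable ?_
      fun_prop
    have e1 : ∀ x : ℝ × ℝ, Complex.exp ((inner ℝ (T x) t : ℝ) * Complex.I)
        = Complex.exp (Complex.I * ((t.fst * x.1 + t.snd * x.2 : ℝ) : ℂ)) := by
      intro x
      rw [mul_comm]
      congr 3
    have := hc t.fst t.snd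
    have e2 : ∀ n, charFun (P n : Measure (WithLp 2 (ℝ × ℝ))) t = ∫ ω, Complex.exp (Complex.I *
      ((t.fst * (Y n ω).1 + t.snd * (Y n ω).2 : ℝ) : ℂ)) ∂μ := by
      intro n
      rw [charFun_apply]
      change ∫ x, _ ∂(μ.map (fun ω => T (Y n ω))) = _
      rw [integral_map (hTY n).aemeasurable (hm _)]
      simp only [e1]
    have e3 : charFun (Q : Measure (WithLp 2 (ℝ × ℝ))) t = ∫ x, Complex.exp (Complex.I *
      ((t.fst * x.1 + t.snd * x.2 : ℝ) : ℂ)) ∂G := by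
      rw [charFun_apply]
      change ∫ x, _ ∂(G.map T) = _
      rw [integral_map hT.aemeasurable (hm _)]
      simp only [e1]
    simp only [e2, e3]
    exact this
  rw [ProbabilityMeasure.tendsto_iff_forall_integral_tendsto] at hPQ
  have := hPQ (f.compContinuous ⟨_, hRc⟩)
  have hm : ∀ ν : Measure (WithLp 2 (ℝ × ℝ)), AEStronglyMeasurable
        (fun x => (f.compContinuous ⟨_, hRc⟩) x) ν := fun ν => by
      refine Continuous.aestronglyMeasurable ?_
      fun_prop
  have e2 : ∀ n, ∫ x, (f.compContinuous ⟨_, hRc⟩) x ∂(P n : Measure (WithLp 2 (ℝ × ℝ)))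
      = ∫ ω, f (Y n ω) ∂μ := by
    intro n
    change ∫ x, _ ∂(μ.map (fun ω => T (Y n ω))) = _
    rw [integral_map (hTY n).aemeasurable (hm _)]
    rfl
  have e3 : ∫ x, (f.compContinuous ⟨_, hRc⟩) x ∂(Q : Measure (WithLp 2 (ℝ × ℝ)))
      = ∫ x, f x ∂G := by
    change ∫ x, _ ∂(G.map T) = _
    rw [integral_map hT.aemeasurable (hm _)]
    rfl
  simp only [e2, e3] at this
  exact this

/-- **Asymptotic normality of the CLS estimator (Theorem 1).**
For the canonical stationary BAR(1) chain (trajectory law `μ`, characterized by its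
finite-dimensional distributions), the law of `√n ((ρ̂_n, p̂_n) - (ρ, p))` converges
weakly to the centered Gaussian `G` on ℝ² with covariance matrix `V⁻¹ W_CLS V⁻¹`
(characterized by its characteristic function). -/
theorem cls_asymptotic_normality
    (N : ℕ) (hN : 1 ≤ N) (p ρ : ℝ) (hp0 : 0 < p) (hp1 : p < 1)
    (hρl : max (-(p / (1 - p))) (-((1 - p) / p)) < ρ) (hρu : ρ < 1)
    (μ : Measure (ℕ → ℕ)) [IsProbabilityMeasure μ]
    (hμ : ∀ (n : ℕ) (x : ℕ → ℕ),
      μ {ω | ∀ t ≤ n, ω t = x t} =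
        ENNReal.ofReal (binomPMF N p (x 0) *
          ∏ t ∈ Finset.Icc 1 n, barK N ρ p (x (t - 1)) (x t)))
    (G : Measure (ℝ × ℝ)) [IsProbabilityMeasure G]
    (hG : ∀ u : ℝ × ℝ,
      ∫ x, Complex.exp (Complex.I * ((u.1 * x.1 + u.2 * x.2 : ℝ) : ℂ)) ∂G =
        Complex.exp
          (((-(![u.1, u.2] ⬝ᵥ
              ((Vmat N ρ p)⁻¹ * Wcls N ρ p * (Vmat N ρ p)⁻¹).mulVec ![u.1, u.2]) / 2 : ℝ) : ℂ))) :
    ∀ f : BoundedContinuousFunction (ℝ × ℝ) ℝ,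
      Tendsto
        (fun n : ℕ => ∫ ω, f (Real.sqrt n * (clsRho (xR ω) n - ρ),
                              Real.sqrt n * (clsP N (xR ω) n - p)) ∂μ)
        atTop (nhds (∫ x, f x ∂G)) := by
  have h := isBarChain_of_cyl N p ρ hp0 hp1 hρl hρu μ hμ
  refine weak_of_char μ G (fun n ω => (Real.sqrt n * (clsRho (xR ω) n - ρ),
    Real.sqrt n * (clsP N (xR ω) n - p))) (fun n => ?_) (fun u1 u2 => ?_)
  · have := measurable_clsRho n
    have := measurable_clsP N n
    fun_prop
  · have h1 := char_lim h hN hp0 hp1 hρu u1 u2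
    have h2 := hG (u1, u2)
    simp only at h2
    rw [h2]
    exact h1
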